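/- Let G be a connected graph and S a 5-configuration of G. Then S splits if and only if there exists an edge e ∈ S such that, setting G' equal to one of G ∖ e or G / e, there exist edge-disjoint subgraphs G_1 and G_2 of G' with G' = G_1 ∪ G_2 satisfying one of the following: (1) |V(G_1) ∩ V(G_2)| ≤ 2 and |E(G_1) ∩ S| = 2; (2) |V(G_1) ∩ V(G_2)| = 1 and |E(G_1) ∩ S| = 1. -/

import Mathlib

/-!  Common definitions: multigraphs, separations, width, minors,
Kirchhoff/Dodgson polynomials, Feynman 5-splitting, enhanced graphs. -/

noncomputable section

attribute [local instance] Classical.propDecidable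

/-- A finite multigraph, given by finite vertex and edge types together with
source and target maps (an arbitrary orientation of each edge). -/
structure Multigraph : Type 1 where
  V : Type
  E : Type
  [fintypeV : Fintype V]
  [fintypeE : Fintype E]
  src : E → V
  tgt : E → V

attribute [instance] Multigraph.fintypeV Multigraph.fintypeE

namespace Multigraph

variable (G : Multigraph)

/-- The endpoints of an edge as an unordered pair. -/
def ends (e : G.E) : Sym2 G.V := s(G.src e, G.tgt e)

/-- Incidence of a vertex with an edge. -/
def inc (v : G.V) (e : G.E) : Prop := v = G.src e ∨ v = G.tgt e

/-- `V(G_A)`: the vertices of the subgraph induced by an edge set `A`. -/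
def edgeVerts (A : Set G.E) : Set G.V := {v | ∃ e ∈ A, G.inc v e}

/-- The order of the separation `(A, Aᶜ)` of the graph `G`,
i.e. `|V(G_A) ∩ V(G_B)|` where `B = Aᶜ`. -/
def sepOrder (A : Set G.E) : ℕ := (G.edgeVerts A ∩ G.edgeVerts Aᶜ).ncard

/-- One step along an edge belonging to the edge set `A`. -/
def stepOn (A : Set G.E) (a b : G.V) : Prop :=
  ∃ e ∈ A, (G.src e = a ∧ G.tgt e = b) ∨ (G.src e = b ∧ G.tgt e = a)

/-- Reachability using only edges in `A`. -/
def reachOn (A : Set G.E) : G.V → G.V → Prop := Relation.ReflTransGen (G.stepOn A)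

/-- Adjacency. -/
def Adj (a b : G.V) : Prop := G.stepOn Set.univ a b

/-- One adjacency step staying inside the vertex set `U`. -/
def stepWithin (U : Set G.V) (a b : G.V) : Prop := a ∈ U ∧ b ∈ U ∧ G.Adj a b

/-- The subgraph induced by the vertex set `U` is (nonempty and) connected. -/
def ConnectedWithin (U : Set G.V) : Prop :=
  U.Nonempty ∧ ∀ a ∈ U, ∀ b ∈ U, Relation.ReflTransGen (G.stepWithin U) a b

/-- Connectivity of the multigraph. -/
def Connected : Prop := G.ConnectedWithin Set.univ

/-- A multigraph is simple if it has no loops and no parallel edges. -/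
def Simple : Prop := (∀ e : G.E, G.src e ≠ G.tgt e) ∧ Function.Injective G.ends

/-- 3-connectivity: at least 4 vertices, and removing fewer than 3 vertices
leaves a connected graph. -/
def ThreeConnected : Prop :=
  4 ≤ Fintype.card G.V ∧ ∀ S : Set G.V, S.ncard < 3 → G.ConnectedWithin Sᶜ

/-- The spanning subgraph with edge set `T` is connected. -/
def ConnectedOn (T : Set G.E) : Prop := ∀ a b : G.V, G.reachOn T a b

/-- The degree of `v` in the spanning subgraph with edge set `T`
(loops count twice). -/
def degOn (T : Set G.E) (v : G.V) : ℕ :=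
  ({e ∈ T | G.src e = v}).ncard + ({e ∈ T | G.tgt e = v}).ncard

/-- The degree of a vertex (loops count twice). -/
def degree (v : G.V) : ℕ := G.degOn Set.univ v

/-- An edge set is a forest (contains no cycle) iff every nonempty subset
has a vertex of degree exactly one. -/
def IsForest (T : Set G.E) : Prop :=
  ∀ T' ⊆ T, T'.Nonempty → ∃ v : G.V, G.degOn T' v = 1

/-- `T` is the edge set of a spanning tree of `G`. -/
def IsSpanningTree (T : Set G.E) : Prop := G.IsForest T ∧ G.ConnectedOn T

/-- The rank of an edge set in the cycle matroid `M(G)`: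
the size of a largest forest contained in it. -/
def rk (A : Set G.E) : ℕ := sSup {n | ∃ T ⊆ A, G.IsForest T ∧ T.ncard = n}

/-- The order of the separation `(A, Aᶜ)` in the cycle matroid `M(G)`,
namely `r(A) + r(Aᶜ) - r(E) + 1`. -/
def msepOrder (A : Set G.E) : ℕ := G.rk A + G.rk Aᶜ + 1 - G.rk Set.univ

/-- The number of connected components of `G_A`, the subgraph induced by the
edge set `A`. -/
def ncompOn (A : Set G.E) : ℕ :=
  ({C : Set G.V | ∃ v ∈ G.edgeVerts A, C = {w | G.reachOn A v w}}).ncard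

/-- `G` has an edge ordering of width at most `k`: every prefix/suffix
separation has order at most `k`. -/
def WidthLE (k : ℕ) : Prop :=
  ∃ f : Fin (Fintype.card G.E) ≃ G.E,
    ∀ ℓ : ℕ,
      G.sepOrder {e | ∃ i : Fin (Fintype.card G.E), f i = e ∧ (i : ℕ) < ℓ} ≤ k

/-- The width of `G`: the minimum width of an edge ordering. -/
def width : ℕ := sInf {k | G.WidthLE k}

/-- The minor of `G` obtained by deleting the edges in `D` and contracting the
edges in `C`. -/
def minorDC (D C : Set G.E) : Multigraph :=
  let rel : G.V → G.V → Prop := fun a b => ∃ e ∈ C, G.src e = a ∧ G.tgt e = b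
  { V := Quot rel
    E := {e : G.E // e ∉ D ∪ C}
    fintypeV := @Fintype.ofFinite _ (Finite.of_surjective (Quot.mk rel) fun q => Quot.exists_rep q)
    fintypeE := Fintype.ofFinite _
    src := fun e => Quot.mk rel (G.src e.1)
    tgt := fun e => Quot.mk rel (G.tgt e.1) }

/-- Deletion of a vertex (together with all incident edges). -/
def deleteVertex (v : G.V) : Multigraph :=
  { V := {w : G.V // w ≠ v}
    E := {e : G.E // ¬ G.inc v e}
    fintypeV := Fintype.ofFinite _
    fintypeE := Fintype.ofFinite _
    src := fun e => ⟨G.src e.1, fun h => e.2 (Or.inl h.symm)⟩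
    tgt := fun e => ⟨G.tgt e.1, fun h => e.2 (Or.inr h.symm)⟩ }

/-- The edges having one endpoint in `X` and the other in `Y`. -/
def crossEdges (X Y : Set G.V) : Set G.E :=
  {e | (G.src e ∈ X ∧ G.tgt e ∈ Y) ∨ (G.src e ∈ Y ∧ G.tgt e ∈ X)}

/-- `G` has `R` as a minor, via branch sets. -/
def HasMinor (R : Multigraph) : Prop :=
  ∃ X : R.V → Set G.V,
    (∀ v : R.V, G.ConnectedWithin (X v)) ∧
    (Pairwise fun v w => Disjoint (X v) (X w)) ∧
    ∀ v w : R.V, v ≠ w →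
      ({f : R.E | R.ends f = s(v, w)}).ncard ≤ (G.crossEdges (X v) (X w)).ncard

/-- `D` is the edge set of a cycle of `G`. -/
def IsCycleSet (D : Set G.E) : Prop :=
  D.Nonempty ∧ (∀ v ∈ G.edgeVerts D, G.degOn D v = 2) ∧
    ∀ a ∈ G.edgeVerts D, ∀ b ∈ G.edgeVerts D, G.reachOn D a b

/-- The side `A` of a separation on `X` is rich: for every `x ∈ X` there is a
cycle `D` avoiding `x` with at most one edge outside `A`. -/
def Rich (A : Set G.E) (X : Set G.V) : Prop :=
  ∀ x ∈ X, ∃ D : Set G.E, G.IsCycleSet D ∧ x ∉ G.edgeVerts D ∧ (D \ A).ncard ≤ 1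

/-- The entry of the (edge × vertex) incidence matrix, as a polynomial. -/
def incCol (e : G.E) (v : G.V) : MvPolynomial G.E ℤ :=
  (if G.src e = v then 1 else 0) - (if G.tgt e = v then 1 else 0)

/-- The expanded Kirchhoff matrix `M_G` (with the column of `v0` deleted). -/
def bigMatrix (v0 : G.V) :
    Matrix (G.E ⊕ {v : G.V // v ≠ v0}) (G.E ⊕ {v : G.V // v ≠ v0}) (MvPolynomial G.E ℤ) :=
  Matrix.of fun r c =>
    match r, c with
    | Sum.inl e, Sum.inl f => if e = f then MvPolynomial.X e else 0
    | Sum.inl e, Sum.inr v => G.incCol e v.1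
    | Sum.inr v, Sum.inl e => - G.incCol e v.1
    | Sum.inr _, Sum.inr _ => 0

/-- The Dodgson polynomial `Ψ^{I,J}_K`: delete the rows indexed by `I` and the
columns indexed by `J` from `M_G`, take the determinant, and set `x_e = 0`
for `e ∈ K`.  (It is well defined up to an overall sign.) -/
def dodgson (v0 : G.V) (I J K : Set G.E) : MvPolynomial G.E ℤ :=
  if h : Nonempty ({e : G.E // e ∉ I} ≃ {e : G.E // e ∉ J}) then
    MvPolynomial.aeval (fun e => if e ∈ K then (0 : MvPolynomial G.E ℤ) else MvPolynomial.X e)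
      (Matrix.det (Matrix.of fun r c =>
        G.bigMatrix v0 (Sum.map Subtype.val id r) (Sum.map (fun x => (h.some x).1) id c)))
  else 0

/-- `(I,J,K)` is one of the 30 Dodgson configurations associated with the
5-configuration `S`. -/
def DodgsonConfig (S I J K : Set G.E) : Prop :=
  I ∪ J ∪ K = S ∧
    ((I.ncard = 2 ∧ J.ncard = 2 ∧ K.ncard = 1 ∧ I ∩ J = ∅ ∧ I ∩ K = ∅ ∧ J ∩ K = ∅) ∨
      (I.ncard = 3 ∧ J.ncard = 3 ∧ K = ∅ ∧ (I ∩ J).ncard = 1))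

/-- The 5-configuration `S` splits: one of its 30 associated Dodgson
polynomials is identically zero. -/
def ConfigSplits (S : Set G.E) : Prop :=
  ∃ I J K : Set G.E, G.DodgsonConfig S I J K ∧ ∀ v0 : G.V, G.dodgson v0 I J K = 0

/-- `G` is Feynman 5-split: every 5-configuration splits. -/
def FeynmanSplit : Prop := ∀ S : Set G.E, S.ncard = 5 → G.ConfigSplits S

/-- `(U, F)` is a subgraph of `G` (every edge of `F` has both ends in `U`). -/
def IsSubgraphPair (U : Set G.V) (F : Set G.E) : Prop :=
  ∀ e ∈ F, G.src e ∈ U ∧ G.tgt e ∈ U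

/-- `G` decomposes into edge-disjoint subgraphs `G₁ ∪ G₂ = G` with
`|V(G₁) ∩ V(G₂)| ≤ 2` and `|E(G₁) ∩ S| = 2`, or with
`|V(G₁) ∩ V(G₂)| = 1` and `|E(G₁) ∩ S| = 1`. -/
def splitWitness (S : Set G.E) : Prop :=
  ∃ (U1 U2 : Set G.V) (F1 F2 : Set G.E),
    G.IsSubgraphPair U1 F1 ∧ G.IsSubgraphPair U2 F2 ∧
    Disjoint F1 F2 ∧ U1 ∪ U2 = Set.univ ∧ F1 ∪ F2 = Set.univ ∧
    (((U1 ∩ U2).ncard ≤ 2 ∧ (F1 ∩ S).ncard = 2) ∨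
      ((U1 ∩ U2).ncard = 1 ∧ (F1 ∩ S).ncard = 1))

/-- A separation of order at most 1 with edges of `S` on both sides, or a
("bad") 2-separation with `min{|A ∩ S|, |B ∩ S|} = 2`. -/
def badSplitSep (S : Set G.E) : Prop :=
  ∃ A : Set G.E,
    (G.sepOrder A ≤ 1 ∧ (A ∩ S).Nonempty ∧ (Aᶜ ∩ S).Nonempty) ∨
      (G.sepOrder A = 2 ∧ min (A ∩ S).ncard (Aᶜ ∩ S).ncard = 2)

/-- Isomorphism of multigraphs. -/
def IsoTo (G' : Multigraph) : Prop :=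
  ∃ (α : G.V ≃ G'.V) (β : G.E ≃ G'.E),
    ∀ e : G.E, G'.ends (β e) = Sym2.map α (G.ends e)

/-- `G` is a tree. -/
def IsTree : Prop := G.Connected ∧ G.IsForest Set.univ

/-- Every vertex has degree 1 or 3. -/
def IsCubic : Prop := ∀ v : G.V, G.degree v = 1 ∨ G.degree v = 3

/-- A leaf. -/
def IsLeaf (v : G.V) : Prop := G.degree v = 1

/-- A cubic caterpillar: a cubic tree whose non-leaf vertices induce a path. -/
def IsCubicCaterpillar : Prop :=
  G.IsTree ∧ G.IsCubic ∧
    (∀ a ∈ {v : G.V | ¬ G.IsLeaf v}, ∀ b ∈ {v : G.V | ¬ G.IsLeaf v},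
      Relation.ReflTransGen (G.stepWithin {v : G.V | ¬ G.IsLeaf v}) a b) ∧
    ∀ v : G.V, ¬ G.IsLeaf v →
      ({e : G.E | G.inc v e ∧ ∃ w : G.V, ¬ G.IsLeaf w ∧ G.inc w e ∧ w ≠ v}).ncard ≤ 2

/-- The branch decomposition `(T, φ)` of the cycle matroid `M(G)` has width at
most `k`: removing any edge `f` of `T` gives a separation of the ground set
of matroid order at most `k`. -/
def branchWidthLE (T : Multigraph) (φ : G.E → T.V) (k : ℕ) : Prop :=
  ∀ f : T.E,
    G.msepOrder {e : G.E | φ e ∈ {x : T.V | T.reachOn {f}ᶜ (T.src f) x}} ≤ k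

/-- `(T, φ)` is a branch decomposition of `M(G)` over a cubic caterpillar. -/
def IsCatDecomp (T : Multigraph) (φ : G.E → T.V) : Prop :=
  T.IsCubicCaterpillar ∧ Function.Injective φ ∧ ∀ e : G.E, T.IsLeaf (φ e)

/-- The caterpillar width of the cycle matroid `M(G)`. -/
def catWidth : ℕ :=
  sInf {k | ∃ (T : Multigraph) (φ : G.E → T.V), G.IsCatDecomp T φ ∧ G.branchWidthLE T φ k}

end Multigraph

/-! ### Concrete graphs -/

/-- The complete graph `K₅`. -/
def K5m : Multigraph where
  V := Fin 5
  E := {p : Fin 5 × Fin 5 // p.1 < p.2}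
  src := fun e => e.1.1
  tgt := fun e => e.1.2

/-- The complete bipartite graph `K₃,₃`. -/
def K33m : Multigraph where
  V := Fin 3 ⊕ Fin 3
  E := Fin 3 × Fin 3
  src := fun e => Sum.inl e.1
  tgt := fun e => Sum.inr e.2

/-- The cube (3-dimensional hypercube) graph `C`. -/
def cubeM : Multigraph where
  V := Fin 2 × Fin 2 × Fin 2
  E := Fin 3 × Fin 2 × Fin 2
  src := fun e =>
    if e.1 = 0 then (0, e.2.1, e.2.2) else if e.1 = 1 then (e.2.1, 0, e.2.2)
      else (e.2.1, e.2.2, 0)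
  tgt := fun e =>
    if e.1 = 0 then (1, e.2.1, e.2.2) else if e.1 = 1 then (e.2.1, 1, e.2.2)
      else (e.2.1, e.2.2, 1)

/-- The octahedron graph `O = K₂,₂,₂`. -/
def octaM : Multigraph where
  V := Fin 3 × Fin 2
  E := {p : (Fin 3 × Fin 2) × (Fin 3 × Fin 2) // p.1.1 < p.2.1}
  src := fun e => e.1.1
  tgt := fun e => e.1.2

/-- The edges of the graph `H` (the cube after a Y–Δ transformation at one
vertex): vertices `0,1,2` form the new triangle, `6` is the antipodal vertex. -/
def hEdgeList : List (Fin 7 × Fin 7) :=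
  [(0,1), (0,2), (1,2), (0,3), (0,4), (1,3), (1,5), (2,4), (2,5), (3,6), (4,6), (5,6)]

/-- The graph `H`, one Δ–Y away from each of the cube and the octahedron. -/
def Hm : Multigraph where
  V := Fin 7
  E := {p : Fin 7 × Fin 7 // p ∈ hEdgeList}
  src := fun e => e.1.1
  tgt := fun e => e.1.2

/-- The complete graph `K₄`. -/
def K4m : Multigraph where
  V := Fin 4
  E := {p : Fin 4 × Fin 4 // p.1 < p.2}
  src := fun e => e.1.1
  tgt := fun e => e.1.2

/-- `K₅⁻`, the complete graph on 5 vertices minus the edge `{3,4}`. -/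
def K5minusM : Multigraph where
  V := Fin 5
  E := {p : Fin 5 × Fin 5 // p.1 < p.2 ∧ ¬(p.1 = 3 ∧ p.2 = 4)}
  src := fun e => e.1.1
  tgt := fun e => e.1.2

/-- The wheel `W_k`: centre `none`; rim edges `Sum.inl i` join `some i` to
`some (i+1)`, spoke edges `Sum.inr i` join the centre to `some i`. -/
def wheelM (k : ℕ) : Multigraph where
  V := Option (Fin k)
  E := Fin k ⊕ Fin k
  src := Sum.elim (fun i => some i) (fun _ => none)
  tgt := Sum.elim (fun i => some (finRotate k i)) (fun i => some i)

/-! ### Enhanced graphs -/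

/-- An enhanced graph: a graph together with sets of contract-proof and
delete-proof edges. -/
structure EGraph : Type 1 where
  G : Multigraph
  Cp : Set G.E
  Dp : Set G.E

namespace EGraph

/-- The 5-configuration `S` of an enhanced graph splits. -/
def Splits (H : EGraph) (S : Set H.G.E) : Prop :=
  H.G.badSplitSep S ∨
    (∃ f ∈ S \ H.Dp, (H.G.minorDC {f} ∅).badSplitSep {e | e.1 ∈ S}) ∨
    (∃ f ∈ S \ H.Cp, (H.G.minorDC ∅ {f}).badSplitSep {e | e.1 ∈ S})

/-- An enhanced graph is non-split if it has a non-split 5-configuration. -/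
def NonSplit (H : EGraph) : Prop := ∃ S : Set H.G.E, S.ncard = 5 ∧ ¬ H.Splits S

/-- Deletion of an edge. -/
def delE (H : EGraph) (f : H.G.E) : EGraph :=
  ⟨H.G.minorDC {f} ∅, {e | e.1 ∈ H.Cp}, {e | e.1 ∈ H.Dp}⟩

/-- Contraction of an edge. -/
def conE (H : EGraph) (f : H.G.E) : EGraph :=
  ⟨H.G.minorDC ∅ {f}, {e | e.1 ∈ H.Cp}, {e | e.1 ∈ H.Dp}⟩

/-- Deletion of a vertex. -/
def delV (H : EGraph) (v : H.G.V) : EGraph :=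
  ⟨H.G.deleteVertex v, {e | e.1 ∈ H.Cp}, {e | e.1 ∈ H.Dp}⟩

/-- Remove an edge from the contract-proof set. -/
def unprotC (H : EGraph) (f : H.G.E) : EGraph := ⟨H.G, H.Cp \ {f}, H.Dp⟩

/-- Remove an edge from the delete-proof set. -/
def unprotD (H : EGraph) (f : H.G.E) : EGraph := ⟨H.G, H.Cp, H.Dp \ {f}⟩

/-- Delete `f'` of a parallel pair `f, f'` and make `f` delete-proof. -/
def parallelReduce (H : EGraph) (f f' : H.G.E) : EGraph :=
  ⟨H.G.minorDC {f'} ∅, {e | e.1 ∈ H.Cp}, {e | e.1 ∈ H.Dp ∨ e.1 = f}⟩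

/-- Contract `f'` of the two edges `f, f'` at a degree-two vertex and make
`f` contract-proof. -/
def seriesReduce (H : EGraph) (f f' : H.G.E) : EGraph :=
  ⟨H.G.minorDC ∅ {f'}, {e | e.1 ∈ H.Cp ∨ e.1 = f}, {e | e.1 ∈ H.Dp}⟩

/-- One step of the enhanced-graph minor relation. -/
inductive MinorStep : EGraph → EGraph → Prop
  | delV (H : EGraph) (v : H.G.V) : MinorStep H (H.delV v)
  | delE (H : EGraph) (f : H.G.E) : MinorStep H (H.delE f)
  | conE (H : EGraph) (f : H.G.E) : MinorStep H (H.conE f)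
  | unprotC (H : EGraph) (f : H.G.E) (hf : f ∈ H.Cp) : MinorStep H (H.unprotC f)
  | unprotD (H : EGraph) (f : H.G.E) (hf : f ∈ H.Dp) : MinorStep H (H.unprotD f)
  | parallel (H : EGraph) (f f' : H.G.E) (hne : f ≠ f')
      (hpar : H.G.ends f = H.G.ends f') : MinorStep H (H.parallelReduce f f')
  | series (H : EGraph) (f f' : H.G.E) (v : H.G.V) (hne : f ≠ f')
      (hf : H.G.inc v f) (hf' : H.G.inc v f')
      (hdeg : ∀ e : H.G.E, H.G.inc v e → e = f ∨ e = f') :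
      MinorStep H (H.seriesReduce f f')

/-- Minor-minimal non-split enhanced graph: non-split, but every proper
enhanced minor is split. -/
def MinorMinimalNonSplit (H : EGraph) : Prop :=
  H.NonSplit ∧ ∀ H' : EGraph, Relation.TransGen MinorStep H H' → ¬ H'.NonSplit

/-- Isomorphism of enhanced graphs. -/
def IsoTo (H H' : EGraph) : Prop :=
  ∃ (α : H.G.V ≃ H'.G.V) (β : H.G.E ≃ H'.G.E),
    (∀ e : H.G.E, H'.G.ends (β e) = Sym2.map α (H.G.ends e)) ∧
    (∀ e : H.G.E, β e ∈ H'.Cp ↔ e ∈ H.Cp) ∧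
    (∀ e : H.G.E, β e ∈ H'.Dp ↔ e ∈ H.Dp)

end EGraph

/-- The edge `01` of `K₄`. -/
def e01K4 : K4m.E := ⟨(0, 1), by decide⟩

/-- The enhanced graph `K₄(1)`: all edges of `K₄` except one are both
contract-proof and delete-proof. -/
def K4one : EGraph := ⟨K4m, {e | e ≠ e01K4}, {e | e ≠ e01K4}⟩

namespace Multigraph

variable (G : Multigraph)

/-- The row of the incidence matrix indexed by the edge `e`, over `ℚ`. -/
def edgeVec (e : G.E) : G.V → ℚ := Pi.single (G.src e) 1 - Pi.single (G.tgt e) 1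

/-- The span of the incidence rows of the edges in `F`. -/
def edgeSpan (F : Set G.E) : Submodule ℚ (G.V → ℚ) := Submodule.span ℚ (G.edgeVec '' F)

/-- The rank of `F` in the cycle matroid, computed linearly. -/
def linRank (F : Set G.E) : ℕ := Module.finrank ℚ (G.edgeSpan F)

variable {G}

lemma edgeVec_mem_edgeSpan {F : Set G.E} {e : G.E} (he : e ∈ F) : G.edgeVec e ∈ G.edgeSpan F :=
  Submodule.subset_span ⟨e, he, rfl⟩

lemma edgeSpan_union (F F' : Set G.E) : G.edgeSpan (F ∪ F') = G.edgeSpan F ⊔ G.edgeSpan F' := by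
  simp [edgeSpan, Set.image_union, Submodule.span_union]

lemma edgeSpan_mono {F F' : Set G.E} (h : F ⊆ F') : G.edgeSpan F ≤ G.edgeSpan F' :=
  Submodule.span_mono (Set.image_mono h)

lemma linRank_mono {F F' : Set G.E} (h : F ⊆ F') : G.linRank F ≤ G.linRank F' :=
  Submodule.finrank_mono (edgeSpan_mono h)

lemma linRank_union_add_inter_le (F F' : Set G.E) :
    G.linRank (F ∪ F') + G.linRank (F ∩ F') ≤ G.linRank F + G.linRank F' := by
  have h := Submodule.finrank_sup_add_finrank_inf_eq (G.edgeSpan F) (G.edgeSpan F')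
  have h2 : G.linRank (F ∩ F') ≤ Module.finrank ℚ ↥(G.edgeSpan F ⊓ G.edgeSpan F') :=
    Submodule.finrank_mono
      (le_inf (edgeSpan_mono Set.inter_subset_left) (edgeSpan_mono Set.inter_subset_right))
  rw [← edgeSpan_union] at h
  simp only [linRank] at *
  omega

lemma linRank_union_le (F F' : Set G.E) : G.linRank (F ∪ F') ≤ G.linRank F + G.linRank F' := by
  have := linRank_union_add_inter_le F F'
  omega

lemma linRank_le_ncard (F : Set G.E) : G.linRank F ≤ F.ncard := by
  have h := finrank_span_le_card (R := ℚ) (G.edgeVec '' F)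
  rw [← Set.ncard_eq_toFinset_card'] at h
  exact h.trans (Set.ncard_image_le (Set.toFinite F))

lemma linRank_singleton_le (e : G.E) : G.linRank {e} ≤ 1 := by
  simpa using linRank_le_ncard {e}

lemma isSubgraphPair_edgeVerts (F : Set G.E) : G.IsSubgraphPair (G.edgeVerts F) F :=
  fun e he => ⟨⟨e, he, Or.inl rfl⟩, ⟨e, he, Or.inr rfl⟩⟩

lemma edgeSpan_apply_eq_zero {F : Set G.E} {U : Set G.V} (hF : G.IsSubgraphPair U F)
    {x : G.V → ℚ} (hx : x ∈ G.edgeSpan F) {v : G.V} (hv : v ∉ U) : x v = 0 := by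
  induction hx using Submodule.span_induction with
  | mem x hx =>
    obtain ⟨e, he, rfl⟩ := hx
    have h1 : v ≠ G.src e := fun h => hv (h ▸ (hF e he).1)
    have h2 : v ≠ G.tgt e := fun h => hv (h ▸ (hF e he).2)
    simp [edgeVec, h1, h2]
  | zero => rfl
  | add x y _ _ hx hy => simp [hx, hy]
  | smul a x _ hx => simp [hx]

lemma edgeVec_mem_span_sub (e : G.E) (U : Set G.V) (v : G.V) (hs : G.src e ∈ U)
    (ht : G.tgt e ∈ U) :
    G.edgeVec e ∈ Submodule.span ℚ
      ((fun u => (Pi.single u 1 - Pi.single v 1 : G.V → ℚ)) '' (U \ {v})) := by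
  have key : ∀ u ∈ U, (Pi.single u 1 - Pi.single v 1 : G.V → ℚ) ∈ Submodule.span ℚ
      ((fun u => (Pi.single u 1 - Pi.single v 1 : G.V → ℚ)) '' (U \ {v})) := by
    intro u hu
    by_cases h : u = v
    · simp [h]
    · exact Submodule.subset_span ⟨u, ⟨hu, h⟩, rfl⟩
  have := Submodule.sub_mem _ (key _ hs) (key _ ht)
  simpa [edgeVec] using this

lemma linRank_add_one_le {F : Set G.E} {U : Set G.V} (hF : G.IsSubgraphPair U F)
    (hU : U.Nonempty) : G.linRank F + 1 ≤ U.ncard := by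
  obtain ⟨v, hv⟩ := hU
  have h1 : G.edgeSpan F ≤ Submodule.span ℚ
      ((fun u => (Pi.single u 1 - Pi.single v 1 : G.V → ℚ)) '' (U \ {v})) := by
    refine Submodule.span_le.2 ?_
    rintro _ ⟨e, he, rfl⟩
    exact edgeVec_mem_span_sub e U v (hF e he).1 (hF e he).2
  have h2 := finrank_span_le_card (R := ℚ)
    ((fun u => (Pi.single u 1 - Pi.single v 1 : G.V → ℚ)) '' (U \ {v}))
  rw [← Set.ncard_eq_toFinset_card'] at h2
  have h3 := Set.ncard_image_le (f := fun u => (Pi.single u 1 - Pi.single v 1 : G.V → ℚ))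
    (Set.toFinite (U \ {v}))
  have h4 := Set.ncard_sdiff_singleton_add_one hv (Set.toFinite U)
  have h5 := Submodule.finrank_mono h1
  simp only [linRank]
  omega

lemma linRank_add_one_le_edgeVerts {F : Set G.E} (hF : F.Nonempty) :
    G.linRank F + 1 ≤ (G.edgeVerts F).ncard := by
  obtain ⟨e, he⟩ := hF
  exact linRank_add_one_le (isSubgraphPair_edgeVerts F) ⟨_, e, he, Or.inl rfl⟩

lemma linRank_add_one_le_card [Nonempty G.V] (F : Set G.E) :
    G.linRank F + 1 ≤ Fintype.card G.V := by
  have := linRank_add_one_le (F := F) (U := Set.univ) (fun _ _ => ⟨trivial, trivial⟩)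
    Set.univ_nonempty
  rwa [Set.ncard_univ, Nat.card_eq_fintype_card] at this

lemma linRank_insert_of_crossing {F : Set G.E} {U : Set G.V} (hF : G.IsSubgraphPair U F)
    {e : G.E} (he : e ∈ G.crossEdges U Uᶜ) : G.linRank F + 1 ≤ G.linRank (insert e F) := by
  refine Submodule.finrank_lt_finrank_of_lt
    (lt_of_le_of_ne (edgeSpan_mono (Set.subset_insert e F)) ?_)
  intro h
  have hmem : G.edgeVec e ∈ G.edgeSpan F := h ▸ edgeVec_mem_edgeSpan (Set.mem_insert e F)
  rcases he with ⟨h1, h2⟩ | ⟨h1, h2⟩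
  · have := edgeSpan_apply_eq_zero hF hmem h2
    have hne : G.tgt e ≠ G.src e := fun h => h2 (h ▸ h1)
    simp [edgeVec, hne] at this
  · have := edgeSpan_apply_eq_zero hF hmem h1
    have hne : G.src e ≠ G.tgt e := fun h => h1 (h ▸ h2)
    simp [edgeVec, hne] at this

lemma linRank_add_le_of_disjoint {F F' : Set G.E}
    (h : Disjoint (G.edgeVerts F) (G.edgeVerts F')) :
    G.linRank F + G.linRank F' ≤ G.linRank (F ∪ F') := by
  have h1 := Submodule.finrank_sup_add_finrank_inf_eq (G.edgeSpan F) (G.edgeSpan F')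
  have h2 : G.edgeSpan F ⊓ G.edgeSpan F' = ⊥ := by
    rw [eq_bot_iff]
    rintro x ⟨hx, hx'⟩
    rw [Submodule.mem_bot]
    funext v
    by_cases hv : v ∈ G.edgeVerts F
    · exact edgeSpan_apply_eq_zero (isSubgraphPair_edgeVerts F') hx' (Set.disjoint_left.1 h hv)
    · exact edgeSpan_apply_eq_zero (isSubgraphPair_edgeVerts F) hx hv
  rw [h2, finrank_bot, ← edgeSpan_union] at h1
  exact h1.ge

/-- If `F` has too small a rank to connect `U`, then `U` splits into two nonempty parts with no
edge of `F` between them. -/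
lemma exists_uncrossed {F : Set G.E} {U : Set G.V} (hU : U.Nonempty)
    (h : G.linRank F + 1 < U.ncard) :
    ∃ W ⊆ U, W.Nonempty ∧ W ≠ U ∧ ∀ e ∈ F, e ∉ G.crossEdges W (U \ W) := by
  by_contra! hcon
  have key : ∀ n : ℕ, 1 ≤ n → n ≤ U.ncard → ∃ W ⊆ U, W.ncard = n ∧
      ∃ F' ⊆ F, G.IsSubgraphPair W F' ∧ n ≤ G.linRank F' + 1 := by
    intro n hn
    induction n, hn using Nat.le_induction with
    | base =>
      intro _
      obtain ⟨v, hv⟩ := hU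
      exact ⟨{v}, by simpa using hv, by simp, ∅, by simp, fun e he => he.elim, by simp⟩
    | succ n hn ih =>
      intro hle
      obtain ⟨W, hWU, hWn, F', hF', hsub, hr⟩ := ih (by omega)
      have hWne : W.Nonempty := (Set.ncard_pos (Set.toFinite W)).1 (by omega)
      obtain ⟨e, heF, he⟩ := hcon W hWU hWne (by rintro rfl; omega)
      have hcross : e ∈ G.crossEdges W Wᶜ := by
        rcases he with ⟨h1, h2⟩ | ⟨h1, h2⟩
        · exact Or.inl ⟨h1, h2.2⟩
        · exact Or.inr ⟨h1.2, h2⟩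
      have hins := linRank_insert_of_crossing hsub hcross
      obtain ⟨v, hvU, hvW, hs, ht⟩ : ∃ v ∈ U, v ∉ W ∧ G.src e ∈ insert v W ∧
          G.tgt e ∈ insert v W := by
        rcases he with ⟨h1, h2⟩ | ⟨h1, h2⟩
        · exact ⟨_, h2.1, h2.2, Or.inr h1, Or.inl rfl⟩
        · exact ⟨_, h1.1, h1.2, Or.inl rfl, Or.inr h2⟩
      refine ⟨insert v W, Set.insert_subset hvU hWU, ?_, insert e F',
        Set.insert_subset heF hF', ?_, by omega⟩
      · rw [Set.ncard_insert_of_notMem hvW (Set.toFinite W), hWn]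
      · rintro f (rfl | hf)
        · exact ⟨hs, ht⟩
        · exact ⟨Or.inr (hsub f hf).1, Or.inr (hsub f hf).2⟩
  obtain ⟨W, -, -, F', hF', -, hr⟩ := key U.ncard (by omega) le_rfl
  have := linRank_mono hF'
  omega

end Multigraph

lemma insert_union_inter_eq {E : Type*} {X Y X' Y' Z : Set E} (e : E) (h : X ∪ Y = Z)
    (h' : X' ∪ Y' = Z) : insert e (X ∪ X') ∪ Y ∩ Y' = insert e Z := by
  subst h
  ext x
  have := Set.ext_iff.1 h' x
  simp only [Set.mem_union, Set.mem_insert_iff, Set.mem_inter_iff] at *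
  tauto

lemma disjoint_insert_union_inter {E : Type*} {X Y X' Y' : Set E} {e : E} (he : e ∉ Y)
    (h : Disjoint X Y) (h' : Disjoint X' Y') : Disjoint (insert e (X ∪ X')) (Y ∩ Y') := by
  rw [Set.disjoint_left] at *
  rintro x (rfl | hx | hx) ⟨hy, hy'⟩
  exacts [he hy, h hx hy, h' hx hy']

/-- A lower bound for the size of a common transversal of two contractions of a matroid with
rank function `r`, in the form of the matroid intersection theorem. -/
lemma exists_common_independent {E : Type*} [Finite E] (r : Set E → ℕ)
    (hmono : ∀ {F F' : Set E}, F ⊆ F' → r F ≤ r F')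
    (hsub : ∀ F F' : Set E, r (F ∪ F') + r (F ∩ F') ≤ r F + r F')
    (hone : ∀ (F : Set E) (e : E), r (insert e F) ≤ r F + 1)
    (Z : Set E) : ∀ (A B : Set E) (k : ℕ),
      (∀ X Y : Set E, X ∪ Y = Z → Disjoint X Y → k + r A + r B ≤ r (X ∪ A) + r (Y ∪ B)) →
      ∃ T ⊆ Z, T.ncard = k ∧ r (T ∪ A) = k + r A ∧ r (T ∪ B) = k + r B := by
  induction Z, Set.toFinite Z using Set.Finite.induction_on with
  | empty =>
    intro A B k h
    have := h ∅ ∅ (by simp) (by simp)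
    simp only [Set.empty_union] at this
    obtain rfl : k = 0 := by omega
    exact ⟨∅, by simp⟩
  | @insert e Z he _ ih =>
    intro A B k h
    by_cases hdel : ∀ X Y : Set E, X ∪ Y = Z → Disjoint X Y →
        k + r A + r B ≤ r (X ∪ A) + r (Y ∪ B)
    · obtain ⟨T, hT, h1⟩ := ih A B k hdel
      exact ⟨T, hT.trans (Set.subset_insert e Z), h1⟩
    push Not at hdel
    obtain ⟨X, Y, hXY, hdXY, hlt⟩ := hdel
    have heX : e ∉ X := fun h' => he (hXY ▸ Or.inl h')
    have heY : e ∉ Y := fun h' => he (hXY ▸ Or.inr h')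
    have hA : r (insert e A) = r A + 1 := by
      have h1 := hone A e
      have h2 := h (insert e X) Y (by rw [Set.insert_union, hXY])
        (Set.disjoint_insert_left.2 ⟨heY, hdXY⟩)
      have h3 := hsub (X ∪ A) (insert e A)
      have h4 : insert e X ∪ A = (X ∪ A) ∪ insert e A := by grind
      have h5 := hmono (show A ⊆ (X ∪ A) ∩ insert e A by grind)
      rw [h4] at h2
      omega
    have hB : r (insert e B) = r B + 1 := by
      have h1 := hone B e
      have h2 := h X (insert e Y) (by rw [Set.union_insert, hXY])
        (Set.disjoint_insert_right.2 ⟨heX, hdXY⟩)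
      have h3 := hsub (Y ∪ B) (insert e B)
      have h4 : insert e Y ∪ B = (Y ∪ B) ∪ insert e B := by grind
      have h5 := hmono (show B ⊆ (Y ∪ B) ∩ insert e B by grind)
      rw [h4] at h2
      omega
    have hk : 1 ≤ k := by
      have h1 := hmono (show A ⊆ X ∪ A by grind)
      have h2 := hmono (show B ⊆ Y ∪ B by grind)
      omega
    have hcon : ∀ X' Y' : Set E, X' ∪ Y' = Z → Disjoint X' Y' →
        (k - 1) + r (insert e A) + r (insert e B) ≤ r (X' ∪ insert e A) + r (Y' ∪ insert e B) := by
      intro X' Y' hXY' hd'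
      by_contra! hlt'
      have hX := hsub (X ∪ A) (X' ∪ insert e A)
      have hY := hsub (Y ∪ B) (Y' ∪ insert e B)
      have e1 := h (insert e (X ∪ X')) (Y ∩ Y')
        (insert_union_inter_eq e hXY hXY') (disjoint_insert_union_inter heY hdXY hd')
      have e2 := h (X ∩ X') (insert e (Y ∪ Y'))
        ((Set.union_comm _ _).trans (insert_union_inter_eq e ((Set.union_comm _ _).trans hXY)
          ((Set.union_comm _ _).trans hXY')))
        (disjoint_insert_union_inter heX hdXY.symm hd'.symm).symm
      have m1 : insert e (X ∪ X') ∪ A = (X ∪ A) ∪ (X' ∪ insert e A) := by clear * -; grind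
      have m2 := hmono (show (Y ∩ Y') ∪ B ⊆ (Y ∪ B) ∩ (Y' ∪ insert e B) by clear * -; grind)
      have m3 := hmono (show (X ∩ X') ∪ A ⊆ (X ∪ A) ∩ (X' ∪ insert e A) by clear * -; grind)
      have m4 : insert e (Y ∪ Y') ∪ B = (Y ∪ B) ∪ (Y' ∪ insert e B) := by clear * -; grind
      rw [m1] at e1
      rw [m4] at e2
      omega
    obtain ⟨T, hT, hTk, hTA, hTB⟩ := ih (insert e A) (insert e B) (k - 1) hcon
    refine ⟨insert e T, Set.insert_subset_insert hT, ?_, ?_, ?_⟩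
    · rw [Set.ncard_insert_of_notMem (fun h' => he (hT h')) (Set.toFinite T)]
      omega
    · rw [Set.insert_union, ← Set.union_insert]
      omega
    · rw [Set.insert_union, ← Set.union_insert]
      omega

namespace Multigraph

variable {G : Multigraph}

/-- The projection of the vertices of `G` to those of a minor. -/
def minorMk (D C : Set G.E) (v : G.V) : (G.minorDC D C).V := Quot.mk _ v

lemma minorMk_surjective (D C : Set G.E) : Function.Surjective (minorMk D C) := Quot.exists_rep

lemma minorMk_empty_injective (D : Set G.E) : Function.Injective (minorMk D (∅ : Set G.E)) := by
  intro v w h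
  have key : ∀ a b : G.V, (∃ e ∈ (∅ : Set G.E), G.src e = a ∧ G.tgt e = b) → a = b := by
    rintro a b ⟨e, he, -⟩
    exact he.elim
  exact congrArg (Quot.lift id key) h

/-- The inclusion of the edges of a minor of `G` in those of `G`. -/
def minorVal (D C : Set G.E) (e : (G.minorDC D C).E) : G.E := e.1

lemma minorVal_injective (D C : Set G.E) : Function.Injective (minorVal D C) :=
  Subtype.val_injective

lemma range_minorVal (D C : Set G.E) : Set.range (minorVal D C) = (D ∪ C)ᶜ :=
  Subtype.range_coe

/-- The linear map between vertex spaces induced by passing to a minor. -/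
def minorPush (D C : Set G.E) : (G.V → ℚ) →ₗ[ℚ] ((G.minorDC D C).V → ℚ) :=
  Fintype.linearCombination ℚ (fun v => Pi.single (minorMk D C v) 1)

lemma minorPush_single (D C : Set G.E) (v : G.V) :
    minorPush D C (Pi.single v 1) = Pi.single (minorMk D C v) 1 := by
  simp [minorPush, Fintype.linearCombination_apply_single]

lemma minorMk_src_eq_tgt {D C : Set G.E} {e : G.E} (he : e ∈ C) :
    minorMk D C (G.src e) = minorMk D C (G.tgt e) :=
  Quot.sound ⟨e, he, rfl, rfl⟩

lemma minorPush_edgeVec_of_mem {D C : Set G.E} {e : G.E} (he : e ∈ C) :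
    minorPush D C (G.edgeVec e) = 0 := by
  rw [edgeVec, map_sub, minorPush_single, minorPush_single, minorMk_src_eq_tgt he, sub_self]

lemma minorPush_edgeVec {D C : Set G.E} (e : (G.minorDC D C).E) :
    minorPush D C (G.edgeVec (minorVal D C e)) = (G.minorDC D C).edgeVec e := by
  rw [edgeVec, map_sub, minorPush_single, minorPush_single]
  rfl

lemma minorPush_surjective (D C : Set G.E) : Function.Surjective (minorPush D C) := by
  rw [← LinearMap.range_eq_top, eq_top_iff, ← (Pi.basisFun ℚ _).span_eq, Submodule.span_le]
  rintro _ ⟨q, rfl⟩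
  obtain ⟨v, rfl⟩ := minorMk_surjective D C q
  exact ⟨Pi.single v 1, by simp [minorPush_single]⟩

lemma ker_minorPush (D C : Set G.E) : LinearMap.ker (minorPush D C) = G.edgeSpan C := by
  apply le_antisymm
  · let θ : ((G.minorDC D C).V → ℚ) →ₗ[ℚ] (G.V → ℚ) ⧸ G.edgeSpan C :=
      Fintype.linearCombination ℚ (Quot.lift
        (fun v : G.V => (G.edgeSpan C).mkQ (Pi.single v 1)) (by
          rintro a b ⟨e, he, rfl, rfl⟩
          rw [← sub_eq_zero, ← map_sub, ← LinearMap.mem_ker, Submodule.ker_mkQ]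
          exact edgeVec_mem_edgeSpan he))
    have hθ : θ ∘ₗ minorPush D C = (G.edgeSpan C).mkQ := by
      refine LinearMap.pi_ext' fun v => LinearMap.ext_ring ?_
      simp only [LinearMap.comp_apply, LinearMap.single_apply, minorPush_single]
      exact (Fintype.linearCombination_apply_single _ _ _ _).trans (one_smul _ _)
    rw [← (G.edgeSpan C).ker_mkQ, ← hθ]
    exact LinearMap.ker_le_ker_comp _ _
  · refine Submodule.span_le.2 ?_
    rintro _ ⟨e, he, rfl⟩
    exact minorPush_edgeVec_of_mem he

lemma card_minor_add (D C : Set G.E) :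
    Fintype.card (G.minorDC D C).V + G.linRank C = Fintype.card G.V := by
  have h := (minorPush D C).finrank_range_add_finrank_ker
  rw [LinearMap.range_eq_top.2 (minorPush_surjective D C), ker_minorPush, finrank_top] at h
  simpa [linRank] using h

lemma linRank_minor_add (D C : Set G.E) (F : Set (G.minorDC D C).E) :
    (G.minorDC D C).linRank F + G.linRank C = G.linRank (minorVal D C '' F ∪ C) := by
  set W := G.edgeSpan (minorVal D C '' F ∪ C) with hW
  have h := ((minorPush D C).domRestrict W).finrank_range_add_finrank_ker
  have hrange : LinearMap.range ((minorPush D C).domRestrict W) =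
      (G.minorDC D C).edgeSpan F := by
    rw [LinearMap.range_domRestrict, hW, edgeSpan_union, Submodule.map_sup,
      show Submodule.map (minorPush D C) (G.edgeSpan C) = ⊥ by
        rw [← ker_minorPush D C]; exact (Submodule.map_le_iff_le_comap.2 le_rfl).antisymm bot_le,
      sup_bot_eq, edgeSpan, edgeSpan, Submodule.map_span, Set.image_image, Set.image_image]
    simp only [minorPush_edgeVec]
  have hker : Module.finrank ℚ (LinearMap.ker ((minorPush D C).domRestrict W)) =
      G.linRank C := by
    rw [LinearMap.ker_domRestrict, ker_minorPush]
    exact (Submodule.comapSubtypeEquivOfLe (edgeSpan_mono Set.subset_union_right)).finrank_eq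
  rw [hrange, hker] at h
  exact h

lemma edgeVerts_union (F F' : Set G.E) :
    G.edgeVerts (F ∪ F') = G.edgeVerts F ∪ G.edgeVerts F' := by
  ext v
  simp only [edgeVerts, Set.mem_ofPred_eq, Set.mem_union, or_and_right, exists_or]

lemma edgeVerts_mono {F F' : Set G.E} (h : F ⊆ F') : G.edgeVerts F ⊆ G.edgeVerts F' :=
  fun _ ⟨e, he, hv⟩ => ⟨e, h he, hv⟩

lemma edgeVerts_nonempty {F : Set G.E} (h : F.Nonempty) : (G.edgeVerts F).Nonempty := by
  obtain ⟨e, he⟩ := h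
  exact ⟨G.src e, e, he, Or.inl rfl⟩

lemma sepOrder_compl (F : Set G.E) : G.sepOrder Fᶜ = G.sepOrder F := by
  rw [sepOrder, sepOrder, compl_compl, Set.inter_comm]

lemma splitWitness_of_sepOrder_le_two {S F : Set G.E} (h : G.sepOrder F ≤ 2)
    (hS : (F ∩ S).ncard = 2) : G.splitWitness S := by
  refine ⟨G.edgeVerts F, (G.edgeVerts F)ᶜ ∪ G.edgeVerts Fᶜ, F, Fᶜ, isSubgraphPair_edgeVerts F,
    fun e he => ⟨Or.inr (isSubgraphPair_edgeVerts _ e he).1,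
      Or.inr (isSubgraphPair_edgeVerts _ e he).2⟩, disjoint_compl_right, ?_, Set.union_compl_self F,
      Or.inl ⟨?_, hS⟩⟩
  · rw [← Set.union_assoc, Set.union_compl_self, Set.univ_union]
  · rwa [Set.inter_union_distrib_left, Set.inter_compl_self, Set.empty_union]

lemma splitWitness_of_sepOrder_le_one {S F : Set G.E} (h : G.sepOrder F ≤ 1)
    (hS : (F ∩ S).ncard = 1) : G.splitWitness S := by
  obtain ⟨v, hv, hcard⟩ : ∃ v ∈ G.edgeVerts F,
      (insert v (G.edgeVerts F ∩ G.edgeVerts Fᶜ)).ncard = 1 := by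
    rcases Nat.le_one_iff_eq_zero_or_eq_one.1 h with h0 | h1
    · have hne : (F ∩ S).Nonempty := (Set.ncard_pos (Set.toFinite _)).1 (by omega)
      obtain ⟨v, hv⟩ := edgeVerts_nonempty (hne.mono Set.inter_subset_left)
      rw [sepOrder, Set.ncard_eq_zero (Set.toFinite _)] at h0
      exact ⟨v, hv, by simp [h0]⟩
    · obtain ⟨v, hv⟩ := Set.ncard_eq_one.1 h1
      have hmem : v ∈ G.edgeVerts F ∩ G.edgeVerts Fᶜ := by simp [hv]
      exact ⟨v, hmem.1, by simp [hv]⟩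
  refine ⟨G.edgeVerts F, insert v ((G.edgeVerts F)ᶜ ∪ G.edgeVerts Fᶜ), F, Fᶜ,
    isSubgraphPair_edgeVerts F, fun e he => ⟨Or.inr (Or.inr (isSubgraphPair_edgeVerts _ e he).1),
      Or.inr (Or.inr (isSubgraphPair_edgeVerts _ e he).2)⟩, disjoint_compl_right, ?_,
      Set.union_compl_self F, Or.inr ⟨?_, hS⟩⟩
  · rw [Set.union_insert, ← Set.union_assoc, Set.union_compl_self, Set.univ_union]
    exact Set.insert_eq_of_mem (Set.mem_univ v)
  · rwa [Set.inter_insert_of_mem hv, Set.inter_union_distrib_left, Set.inter_compl_self,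
      Set.empty_union]

/-- An edge set that cannot be split into vertex-disjoint parts has the rank of a connected
graph. -/
lemma ncard_edgeVerts_le_of_unsplit {F : Set G.E} (hF : F.Nonempty)
    (h : ∀ C D : Set G.E, C.Nonempty → D.Nonempty → C ∪ D = F →
      ¬ Disjoint (G.edgeVerts C) (G.edgeVerts D)) :
    (G.edgeVerts F).ncard ≤ G.linRank F + 1 := by
  by_contra! hlt
  obtain ⟨W, hWU, ⟨w, hw⟩, hne, hcross⟩ := exists_uncrossed (edgeVerts_nonempty hF) hlt
  obtain ⟨u, huU, huW⟩ := Set.exists_of_ssubset (hWU.ssubset_of_ne hne)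
  have hin : ∀ e ∈ F, ∀ v, G.inc v e → (v ∈ W ↔ G.src e ∈ W) := by
    intro e he v hv
    have hpair := isSubgraphPair_edgeVerts F e he
    have hc := hcross e he
    simp only [crossEdges, Set.mem_ofPred_eq, Set.mem_sdiff] at hc
    rcases hv with rfl | rfl <;> tauto
  refine h {e ∈ F | G.src e ∈ W} {e ∈ F | G.src e ∉ W} ?_ ?_ ?_ ?_
  · obtain ⟨e, he, hv⟩ := hWU hw
    exact ⟨e, he, (hin e he w hv).1 hw⟩
  · obtain ⟨e, he, hv⟩ := huU
    exact ⟨e, he, fun h' => huW ((hin e he u hv).2 h')⟩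
  · ext e
    simp only [Set.mem_union, Set.mem_ofPred_eq]
    tauto
  · rw [Set.disjoint_left]
    rintro v ⟨e, ⟨he, hs⟩, hv⟩ ⟨f, ⟨hf, hs'⟩, hv'⟩
    exact hs' ((hin f hf v hv').1 ((hin e he v hv).2 hs))

lemma disjoint_of_disjoint_edgeVerts {C D : Set G.E}
    (h : Disjoint (G.edgeVerts C) (G.edgeVerts D)) : Disjoint C D :=
  Set.disjoint_left.2 fun e hC hD =>
    Set.disjoint_left.1 h ⟨e, hC, Or.inl rfl⟩ ⟨e, hD, Or.inl rfl⟩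

lemma compl_of_disjoint_edgeVerts {C D F : Set G.E} (hCD : C ∪ D = F)
    (h : Disjoint (G.edgeVerts C) (G.edgeVerts D)) : Cᶜ = D ∪ Fᶜ := by
  have := Set.disjoint_left.1 (disjoint_of_disjoint_edgeVerts h)
  subst hCD
  ext e
  simp only [Set.mem_compl_iff, Set.mem_union]
  have := @this e
  tauto

lemma edgeVerts_inter_compl {C D F : Set G.E} (hCD : C ∪ D = F)
    (h : Disjoint (G.edgeVerts C) (G.edgeVerts D)) :
    G.edgeVerts C ∩ G.edgeVerts Cᶜ = G.edgeVerts C ∩ G.edgeVerts Fᶜ := by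
  rw [compl_of_disjoint_edgeVerts hCD h, edgeVerts_union, Set.inter_union_distrib_left,
    h.inter_eq, Set.empty_union]

lemma sepOrder_add_le {C D F : Set G.E} (hCD : C ∪ D = F)
    (h : Disjoint (G.edgeVerts C) (G.edgeVerts D)) :
    G.sepOrder C + G.sepOrder D ≤ G.sepOrder F := by
  rw [sepOrder, sepOrder, sepOrder, edgeVerts_inter_compl hCD h,
    edgeVerts_inter_compl ((Set.union_comm D C).trans hCD) h.symm,
    ← Set.ncard_union_eq (h.mono Set.inter_subset_left Set.inter_subset_left)
      (Set.toFinite _) (Set.toFinite _), ← Set.union_inter_distrib_right, ← edgeVerts_union, hCD]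

lemma ncard_inter_add {C D F : Set G.E} (S : Set G.E) (hCD : C ∪ D = F)
    (h : Disjoint (G.edgeVerts C) (G.edgeVerts D)) :
    (C ∩ S).ncard + (D ∩ S).ncard = (F ∩ S).ncard := by
  rw [← hCD, Set.union_inter_distrib_right, Set.ncard_union_eq
    ((disjoint_of_disjoint_edgeVerts h).mono Set.inter_subset_left Set.inter_subset_left)
    (Set.toFinite _) (Set.toFinite _)]

lemma edgeVerts_inter_compl_nonempty (hconn : Fintype.card G.V ≤ G.linRank Set.univ + 1)
    {C : Set G.E} (hC : C.Nonempty) (hC' : Cᶜ.Nonempty) :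
    (G.edgeVerts C ∩ G.edgeVerts Cᶜ).Nonempty := by
  by_contra hcon
  have h1 := linRank_add_one_le_edgeVerts hC
  have h2 := linRank_add_one_le_edgeVerts hC'
  have h3 := linRank_union_le C Cᶜ
  have h4 := Set.ncard_union_add_ncard_inter (G.edgeVerts C) (G.edgeVerts Cᶜ)
    (Set.toFinite _) (Set.toFinite _)
  have h5 := Set.ncard_le_card (G.edgeVerts C ∪ G.edgeVerts Cᶜ)
  rw [Set.not_nonempty_iff_eq_empty.1 hcon, Set.ncard_empty] at h4
  rw [Set.union_compl_self] at h3
  rw [Nat.card_eq_fintype_card] at h5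
  omega

/-- `F` and its complement each contain two edges of `S` and form a separation of order at most
two in the cycle matroid. -/
def IsRankSep (S F : Set G.E) : Prop :=
  (F ∩ S).ncard = 2 ∧ (Fᶜ ∩ S).ncard = 2 ∧
    G.linRank F + G.linRank Fᶜ ≤ G.linRank Set.univ + 1

lemma IsRankSep.compl {S F : Set G.E} (h : IsRankSep S F) : IsRankSep S Fᶜ := by
  refine ⟨h.2.1, by rw [compl_compl]; exact h.1, ?_⟩
  rw [compl_compl, add_comm]
  exact h.2.2

lemma IsRankSep.inter_nonempty_of_split (hconn : Fintype.card G.V ≤ G.linRank Set.univ + 1)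
    {S F : Set G.E} (hF : IsRankSep S F)
    (hmin : ∀ F', IsRankSep S F' → G.sepOrder F ≤ G.sepOrder F') {C D : Set G.E}
    (hC : C.Nonempty) (hCD : C ∪ D = F) (hd : Disjoint (G.edgeVerts C) (G.edgeVerts D)) :
    (C ∩ S).Nonempty := by
  by_contra hcon
  rw [Set.not_nonempty_iff_eq_empty] at hcon
  have hDC : D ∪ C = F := (Set.union_comm D C).trans hCD
  have hDc : Dᶜ = C ∪ Fᶜ := compl_of_disjoint_edgeVerts hDC hd.symm
  have hcard := ncard_inter_add S hCD hd
  rw [hcon, Set.ncard_empty, zero_add] at hcard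
  have hD : IsRankSep S D := by
    refine ⟨hcard.trans hF.1, ?_, ?_⟩
    · rw [hDc, Set.union_inter_distrib_right, hcon, Set.empty_union]
      exact hF.2.1
    · have h1 := linRank_add_le_of_disjoint hd
      have h2 := linRank_union_le C Fᶜ
      have h3 := hF.2.2
      rw [hCD] at h1
      rw [hDc]
      omega
  have hFc : Fᶜ.Nonempty := by
    have hne : (Fᶜ ∩ S).Nonempty := (Set.ncard_pos (Set.toFinite _)).1 (by rw [hF.2.1]; omega)
    exact hne.mono Set.inter_subset_left
  obtain ⟨v, hv⟩ := edgeVerts_inter_compl_nonempty hconn hC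
    (hFc.mono (Set.compl_subset_compl.2 (hCD ▸ Set.subset_union_left)))
  have hpos : 0 < G.sepOrder C := (Set.ncard_pos (Set.toFinite _)).2 ⟨v, hv⟩
  have := sepOrder_add_le hCD hd
  have := hmin D hD
  omega

lemma IsRankSep.connected_or_split (hconn : Fintype.card G.V ≤ G.linRank Set.univ + 1)
    {S F : Set G.E} (hF : IsRankSep S F)
    (hmin : ∀ F', IsRankSep S F' → G.sepOrder F ≤ G.sepOrder F') :
    (G.edgeVerts F).ncard ≤ G.linRank F + 1 ∨
      ∃ C D : Set G.E, C ∪ D = F ∧ Disjoint (G.edgeVerts C) (G.edgeVerts D) ∧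
        (C ∩ S).ncard = 1 ∧ (D ∩ S).ncard = 1 ∧ (G.edgeVerts F).ncard ≤ G.linRank F + 2 := by
  have meets := fun {C D : Set G.E} => hF.inter_nonempty_of_split hconn hmin (C := C) (D := D)
  by_cases hsplit : ∃ C D : Set G.E, C.Nonempty ∧ D.Nonempty ∧ C ∪ D = F ∧
      Disjoint (G.edgeVerts C) (G.edgeVerts D)
  swap
  · have hne : (F ∩ S).Nonempty := (Set.ncard_pos (Set.toFinite _)).1 (by rw [hF.1]; omega)
    exact Or.inl (ncard_edgeVerts_le_of_unsplit (hne.mono Set.inter_subset_left)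
      fun C D hC hD hCD hd => hsplit ⟨C, D, hC, hD, hCD, hd⟩)
  obtain ⟨C, D, hC, hD, hCD, hd⟩ := hsplit
  have hDC : D ∪ C = F := (Set.union_comm D C).trans hCD
  have hsum := ncard_inter_add S hCD hd
  have hC1 := (Set.ncard_pos (Set.toFinite _)).2 (meets hC hCD hd)
  have hD1 := (Set.ncard_pos (Set.toFinite _)).2 (meets hD hDC hd.symm)
  rw [hF.1] at hsum
  have unsplit : ∀ C D : Set G.E, C.Nonempty → C ∪ D = F →
      Disjoint (G.edgeVerts C) (G.edgeVerts D) → (C ∩ S).ncard = 1 →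
      (G.edgeVerts C).ncard ≤ G.linRank C + 1 := by
    intro C D hC hCD hd hone
    refine ncard_edgeVerts_le_of_unsplit hC fun C₁ C₂ h₁ h₂ h₁₂ hdis => ?_
    have hv : G.edgeVerts C = G.edgeVerts C₁ ∪ G.edgeVerts C₂ := by
      rw [← h₁₂, edgeVerts_union]
    rw [hv, Set.disjoint_union_left] at hd
    have hn₁ := meets h₁ (D := C₂ ∪ D) (by rw [← Set.union_assoc, h₁₂, hCD])
      (by rw [edgeVerts_union]; exact Set.disjoint_union_right.2 ⟨hdis, hd.1⟩)
    have hn₂ := meets h₂ (D := C₁ ∪ D)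
      (by rw [← Set.union_assoc, Set.union_comm C₂ C₁, h₁₂, hCD])
      (by rw [edgeVerts_union]; exact Set.disjoint_union_right.2 ⟨hdis.symm, hd.2⟩)
    have h := ncard_inter_add S h₁₂ hdis
    have hp₁ := (Set.ncard_pos (Set.toFinite _)).2 hn₁
    have hp₂ := (Set.ncard_pos (Set.toFinite _)).2 hn₂
    omega
  have hrC := unsplit C D hC hCD hd (by omega)
  have hrD := unsplit D C hD hDC hd.symm (by omega)
  have hr := linRank_add_le_of_disjoint hd
  have hle := Set.ncard_union_le (G.edgeVerts C) (G.edgeVerts D)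
  rw [← edgeVerts_union, hCD] at hle
  rw [hCD] at hr
  exact Or.inr ⟨C, D, hCD, hd, by omega, by omega, by omega⟩

/-- In a cyclic arrangement of four pieces, the union of two that meet has two attachment
vertices. -/
lemma sepOrder_union_le_two {F C₁ C₂ D₁ D₂ : Set G.E} (hC : C₁ ∪ C₂ = F) (hD : D₁ ∪ D₂ = Fᶜ)
    (hdC : Disjoint (G.edgeVerts C₁) (G.edgeVerts C₂))
    (hdD : Disjoint (G.edgeVerts D₁) (G.edgeVerts D₂))
    (hC₁ : G.sepOrder C₁ ≤ 2) (hD₁ : G.sepOrder D₁ ≤ 2)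
    (hmeet : (G.edgeVerts C₁ ∩ G.edgeVerts D₁).Nonempty) : G.sepOrder (C₁ ∪ D₁) ≤ 2 := by
  obtain ⟨w, hwC, hwD⟩ := hmeet
  have hCF : C₁ ⊆ F := hC ▸ Set.subset_union_left
  have hDF : D₁ ⊆ Fᶜ := hD ▸ Set.subset_union_left
  have hD₁C : D₁ ⊆ C₁ᶜ := hDF.trans (Set.compl_subset_compl.2 hCF)
  have hC₁D : C₁ ⊆ D₁ᶜ := Set.subset_compl_comm.1 hD₁C
  have hrest : (C₁ ∪ D₁)ᶜ ⊆ C₂ ∪ D₂ := by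
    intro e he
    by_cases heF : e ∈ F
    · exact Or.inl (((hC ▸ heF : e ∈ C₁ ∪ C₂)).resolve_left fun h => he (Or.inl h))
    · exact Or.inr ((hD ▸ heF : e ∈ D₁ ∪ D₂).resolve_left fun h => he (Or.inr h))
  have hsub : G.edgeVerts (C₁ ∪ D₁) ∩ G.edgeVerts (C₁ ∪ D₁)ᶜ ⊆
      ((G.edgeVerts C₁ ∩ G.edgeVerts C₁ᶜ) \ {w}) ∪
        ((G.edgeVerts D₁ ∩ G.edgeVerts D₁ᶜ) \ {w}) := by
    rintro v ⟨hv, hv'⟩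
    rw [edgeVerts_union] at hv
    have hv'' := edgeVerts_mono hrest hv'
    rw [edgeVerts_union] at hv''
    have hvw : v ≠ w := by
      rintro rfl
      rcases hv'' with h | h
      · exact Set.disjoint_left.1 hdC hwC h
      · exact Set.disjoint_left.1 hdD hwD h
    rcases hv with h | h
    · exact Or.inl ⟨⟨h, edgeVerts_mono (Set.compl_subset_compl.2 Set.subset_union_left) hv'⟩, hvw⟩
    · exact Or.inr ⟨⟨h, edgeVerts_mono (Set.compl_subset_compl.2 Set.subset_union_right) hv'⟩, hvw⟩
  have h1 := Set.ncard_le_ncard hsub (Set.toFinite _)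
  have h2 := Set.ncard_union_le ((G.edgeVerts C₁ ∩ G.edgeVerts C₁ᶜ) \ {w})
    ((G.edgeVerts D₁ ∩ G.edgeVerts D₁ᶜ) \ {w})
  have h3 := Set.ncard_sdiff_singleton_add_one
    (show w ∈ G.edgeVerts C₁ ∩ G.edgeVerts C₁ᶜ from ⟨hwC, edgeVerts_mono hD₁C hwD⟩)
    (Set.toFinite _)
  have h4 := Set.ncard_sdiff_singleton_add_one
    (show w ∈ G.edgeVerts D₁ ∩ G.edgeVerts D₁ᶜ from ⟨hwD, edgeVerts_mono hC₁D hwC⟩)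
    (Set.toFinite _)
  simp only [sepOrder] at *
  omega

/-- A matroid separation of order at most two in a connected graph, with two edges of `S` on each
side, yields a vertex separation. -/
theorem IsRankSep.splitWitness (hconn : Fintype.card G.V ≤ G.linRank Set.univ + 1)
    {S F₀ : Set G.E} (hF₀ : IsRankSep S F₀) : G.splitWitness S := by
  obtain ⟨F, hF, hmin⟩ := Set.exists_min_image {F : Set G.E | IsRankSep S F} G.sepOrder
    (Set.toFinite _) ⟨F₀, hF₀⟩
  have hF : IsRankSep S F := hF
  have hmin : ∀ F', IsRankSep S F' → G.sepOrder F ≤ G.sepOrder F' := hmin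
  have hne : (F ∩ S).Nonempty := (Set.ncard_pos (Set.toFinite _)).1 (by rw [hF.1]; omega)
  have hcount := Set.ncard_union_add_ncard_inter (G.edgeVerts F) (G.edgeVerts Fᶜ)
    (Set.toFinite _) (Set.toFinite _)
  rw [← edgeVerts_union, Set.union_compl_self] at hcount
  change _ + G.sepOrder F = _ at hcount
  have huniv := linRank_add_one_le_edgeVerts (F := (Set.univ : Set G.E))
    (hne.mono (fun _ _ => trivial))
  have hrank := hF.2.2
  have hFc := sepOrder_compl F
  rcases hF.connected_or_split hconn hmin with hA | ⟨C₁, C₂, hC, hdC, hC₁, hC₂, hA⟩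
  · rcases hF.compl.connected_or_split hconn (by rwa [hFc]) with
      hB | ⟨D₁, D₂, hD, hdD, hD₁, hD₂, hB⟩
    · exact splitWitness_of_sepOrder_le_two (by omega) hF.1
    · have := sepOrder_add_le hD hdD
      by_cases h1 : G.sepOrder D₁ ≤ 1
      · exact splitWitness_of_sepOrder_le_one h1 hD₁
      · exact splitWitness_of_sepOrder_le_one (by omega) hD₂
  · have hsum := sepOrder_add_le hC hdC
    by_cases hc1 : G.sepOrder C₁ ≤ 1
    · exact splitWitness_of_sepOrder_le_one hc1 hC₁
    by_cases hc2 : G.sepOrder C₂ ≤ 1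
    · exact splitWitness_of_sepOrder_le_one hc2 hC₂
    rcases hF.compl.connected_or_split hconn (by rwa [hFc]) with
      hB | ⟨D₁, D₂, hD, hdD, hD₁, hD₂, hB⟩
    · omega
    have hsum' := sepOrder_add_le hD hdD
    by_cases hd1 : G.sepOrder D₁ ≤ 1
    · exact splitWitness_of_sepOrder_le_one hd1 hD₁
    by_cases hd2 : G.sepOrder D₂ ≤ 1
    · exact splitWitness_of_sepOrder_le_one hd2 hD₂
    have two : ∀ D : Set G.E, D ⊆ Fᶜ → (D ∩ S).ncard = 1 → ((C₁ ∪ D) ∩ S).ncard = 2 := by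
      intro D hDF hDS
      have hdis : Disjoint C₁ D := Set.disjoint_left.2 fun e he hD =>
        hDF hD (hC ▸ Or.inl he)
      rw [Set.union_inter_distrib_right, Set.ncard_union_eq
        (hdis.mono Set.inter_subset_left Set.inter_subset_left)
        (Set.toFinite _) (Set.toFinite _), hC₁, hDS]
    obtain ⟨v, hv⟩ : (G.edgeVerts C₁ ∩ G.edgeVerts C₁ᶜ).Nonempty :=
      (Set.ncard_pos (Set.toFinite _)).1 (by change 0 < G.sepOrder C₁; omega)
    rw [edgeVerts_inter_compl hC hdC, ← hD, edgeVerts_union] at hv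
    rcases hv.2 with h | h
    · exact splitWitness_of_sepOrder_le_two (sepOrder_union_le_two hC hD hdC hdD (by omega)
        (by omega) ⟨v, hv.1, h⟩) (two D₁ (hD ▸ Set.subset_union_left) hD₁)
    · exact splitWitness_of_sepOrder_le_two (sepOrder_union_le_two hC
        ((Set.union_comm D₂ D₁).trans hD) hdC hdD.symm (by omega)
        (by omega) ⟨v, hv.1, h⟩) (two D₂ (hD ▸ Set.subset_union_right) hD₂)

end Multigraph

lemma MvPolynomial.det_affine_rows_ne_zero_iff {n σ : Type*} [Fintype n] [DecidableEq n] {x : n → σ}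
    (hx : Function.Injective x) (A N : Matrix n n ℤ) :
    Matrix.det (Matrix.of fun i j =>
        MvPolynomial.X (x i) * MvPolynomial.C (A i j) + MvPolynomial.C (N i j)) ≠
        (0 : MvPolynomial σ ℤ) ↔
      ∃ s : Finset n, Matrix.det (Matrix.of fun i j => if i ∈ s then A i j else N i j) ≠ 0 := by
  set m : Finset n → σ →₀ ℕ := fun s => ∑ i ∈ s, Finsupp.single (x i) 1 with hm
  have happ : ∀ s i, m s (x i) = if i ∈ s then 1 else 0 := by
    intro s i
    simp [hm, Finsupp.finsetSum_apply, Finsupp.single_apply, hx.eq_iff]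
  have hinj : Function.Injective m := by
    intro s t hst
    ext i
    have h := happ s i
    rw [hst, happ t i] at h
    by_cases h1 : i ∈ s <;> by_cases h2 : i ∈ t <;> simp_all
  have key : Matrix.det (Matrix.of fun i j =>
      MvPolynomial.X (x i) * MvPolynomial.C (A i j) + MvPolynomial.C (N i j)) =
      ∑ s : Finset n, MvPolynomial.monomial (m s)
        (Matrix.det (Matrix.of fun i j => if i ∈ s then A i j else N i j)) := by
    have h1 := (Matrix.detRowAlternating (n := n) (R := MvPolynomial σ ℤ)).map_add_univ
      (fun i j => MvPolynomial.X (x i) * MvPolynomial.C (A i j)) (fun i j => MvPolynomial.C (N i j))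
    refine h1.trans (Finset.sum_congr rfl fun s _ => ?_)
    set B : Matrix n n (MvPolynomial σ ℤ) :=
      (Matrix.of fun i j => if i ∈ s then A i j else N i j).map MvPolynomial.C with hB
    have h2 := (Matrix.detRowAlternating (n := n)
      (R := MvPolynomial σ ℤ)).toMultilinearMap.map_piecewise_smul
        (fun i => MvPolynomial.X (x i)) B s
    have h3 : (s.piecewise (fun i j => MvPolynomial.X (x i) * MvPolynomial.C (A i j))
        (fun i j => MvPolynomial.C (N i j)) : n → n → MvPolynomial σ ℤ) =
        s.piecewise (fun i => (MvPolynomial.X (x i) : MvPolynomial σ ℤ) • B i) B := by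
      funext i j
      by_cases hi : i ∈ s <;> simp [Finset.piecewise, hi, hB]
    rw [h3]
    refine h2.trans ?_
    have h4 : B.det =
        MvPolynomial.C (Matrix.det (Matrix.of fun i j => if i ∈ s then A i j else N i j)) :=
      (RingHom.map_det _ _).symm
    have h5 : MvPolynomial.monomial (m s) (1 : ℤ) = ∏ i ∈ s, MvPolynomial.X (x i) :=
      MvPolynomial.monomial_sum_one _ _
    change _ • B.det = _
    rw [h4, ← h5, smul_eq_mul, mul_comm, MvPolynomial.C_mul_monomial, mul_one]
  rw [key, not_iff_comm]
  push Not
  constructor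
  · intro h
    simp [h]
  · intro h s
    have := congrArg (MvPolynomial.coeff (m s)) h
    simpa [MvPolynomial.coeff_sum, MvPolynomial.coeff_monomial, hinj.eq_iff] using this

namespace Multigraph

variable {G : Multigraph}

lemma linRank_eq_ncard_iff (F : Set G.E) :
    G.linRank F = F.ncard ↔
      ∀ y : G.E → ℚ, (∀ e ∉ F, y e = 0) → ∑ e, y e • G.edgeVec e = 0 → y = 0 := by
  have h := linearIndependent_iff_card_eq_finrank_span (R := ℚ) (b := fun e : F => G.edgeVec e)
  have hr : Set.range (fun e : F => G.edgeVec e) = G.edgeVec '' F := by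
    ext; simp
  rw [hr] at h
  have hc : Fintype.card F = F.ncard := by
    rw [← Nat.card_eq_fintype_card, Nat.card_coe_set_eq]
  rw [hc, Fintype.linearIndependent_iff] at h
  rw [eq_comm]
  have hsum : ∀ y : G.E → ℚ, (∀ e ∉ F, y e = 0) →
      ∑ e : F, y e • G.edgeVec e = ∑ e, y e • G.edgeVec e := by
    intro y hy
    rw [← Finset.sum_subtype (Finset.univ.filter (· ∈ F)) (by simp) fun e => y e • G.edgeVec e]
    exact Finset.sum_subset (Finset.subset_univ _) fun e _ he => by simp [hy e (by simpa using he)]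
  refine h.symm.trans ⟨fun H y hy hs => ?_, fun H g hg e => ?_⟩
  · have := H (fun e => y e) ((hsum y hy).trans hs)
    funext e
    by_cases he : e ∈ F
    · exact this ⟨e, he⟩
    · exact hy e he
  · have hy : ∀ e ∉ F, (if he : e ∈ F then g ⟨e, he⟩ else 0) = 0 := fun e he => by simp [he]
    have := H _ hy ((hsum _ hy).symm.trans (by simpa using hg))
    simpa using congrFun this e

lemma card_le_linRank_add_one_iff [Nonempty G.V] (F : Set G.E) :
    Fintype.card G.V ≤ G.linRank F + 1 ↔
      ∀ z : G.V → ℚ, (∀ e ∈ F, z (G.src e) = z (G.tgt e)) → ∀ v w, z v = z w := by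
  constructor
  · intro h z hz v w
    by_contra hne
    set W : Set G.V := {u | z u = z v} with hW
    have hvW : v ∈ W := rfl
    have hwW : w ∈ Wᶜ := fun h => hne h.symm
    have h1 : G.linRank (F ∩ {e | G.src e ∈ W}) + 1 ≤ W.ncard :=
      linRank_add_one_le (fun e he => ⟨he.2, (hz e he.1).symm.trans he.2⟩) ⟨v, hvW⟩
    have h2 : G.linRank (F ∩ {e | G.src e ∉ W}) + 1 ≤ Wᶜ.ncard :=
      linRank_add_one_le (fun e he => ⟨he.2, fun h => he.2 ((hz e he.1).trans h)⟩) ⟨w, hwW⟩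
    have h3 := linRank_union_le (F ∩ {e | G.src e ∈ W}) (F ∩ {e | G.src e ∉ W})
    have h4 : F ∩ {e | G.src e ∈ W} ∪ F ∩ {e | G.src e ∉ W} = F := by
      ext e
      by_cases h : G.src e ∈ W <;> simp [h]
    rw [h4] at h3
    have h5 := Set.ncard_add_ncard_compl W
    rw [Nat.card_eq_fintype_card] at h5
    omega
  · intro H
    by_contra h
    obtain ⟨W, -, ⟨a, ha⟩, hne, hcr⟩ := exists_uncrossed (F := F) (U := Set.univ) Set.univ_nonempty
      (by rw [Set.ncard_univ, Nat.card_eq_fintype_card]; omega)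
    obtain ⟨b, hb⟩ := (Set.ne_univ_iff_exists_notMem W).1 hne
    have := H (W.indicator 1) (fun e he => by
      have := hcr e he
      simp only [crossEdges, Set.mem_ofPred_eq, Set.mem_sdiff, Set.mem_univ, true_and] at this
      by_cases h1 : G.src e ∈ W <;> by_cases h2 : G.tgt e ∈ W <;> simp_all) a b
    simp [ha, hb] at this

/-- The coefficient matrix of the edge variables in a Dodgson matrix. -/
def dodgsonLin (v0 : G.V) (I J K : Set G.E) (φ : {e : G.E // e ∉ I} ≃ {e : G.E // e ∉ J}) :
    Matrix ({e : G.E // e ∉ I} ⊕ {v : G.V // v ≠ v0})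
      ({e : G.E // e ∉ I} ⊕ {v : G.V // v ≠ v0}) ℤ :=
  Matrix.of fun r c =>
    match r, c with
    | Sum.inl e, Sum.inl f => if e.1 = (φ f).1 ∧ e.1 ∉ K then 1 else 0
    | Sum.inl _, Sum.inr _ => 0
    | Sum.inr _, Sum.inl _ => 0
    | Sum.inr _, Sum.inr _ => 0

/-- The constant part of a Dodgson matrix. -/
def dodgsonConst (v0 : G.V) (I J : Set G.E) (φ : {e : G.E // e ∉ I} ≃ {e : G.E // e ∉ J}) :
    Matrix ({e : G.E // e ∉ I} ⊕ {v : G.V // v ≠ v0})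
      ({e : G.E // e ∉ I} ⊕ {v : G.V // v ≠ v0}) ℤ :=
  Matrix.of fun r c =>
    match r, c with
    | Sum.inl _, Sum.inl _ => 0
    | Sum.inl e, Sum.inr v =>
        (if G.src e = v then 1 else 0) - (if G.tgt e = v then 1 else 0)
    | Sum.inr v, Sum.inl e =>
        -((if G.src (φ e).1 = v then 1 else 0) - (if G.tgt (φ e).1 = v then 1 else 0))
    | Sum.inr _, Sum.inr _ => 0

lemma dodgson_ne_zero_iff_exists_det (v0 : G.V) {I J : Set G.E} (K : Set G.E)
    (h : Nonempty ({e : G.E // e ∉ I} ≃ {e : G.E // e ∉ J})) :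
    G.dodgson v0 I J K ≠ 0 ↔ ∃ s : Finset ({e : G.E // e ∉ I} ⊕ {v : G.V // v ≠ v0}),
      Matrix.det (Matrix.of fun r c =>
        if r ∈ s then dodgsonLin v0 I J K h.some r c else dodgsonConst v0 I J h.some r c) ≠ 0 := by
  have hx : Function.Injective
      (Sum.map Subtype.val id : {e : G.E // e ∉ I} ⊕ {v : G.V // v ≠ v0} → G.E ⊕ _) :=
    Sum.map_injective.2 ⟨Subtype.val_injective, Function.injective_id⟩
  rw [← MvPolynomial.det_affine_rows_ne_zero_iff hx, dodgson, dif_pos h,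
    ← (MvPolynomial.rename_injective (R := ℤ)
      (Sum.inl : G.E → G.E ⊕ {v : G.V // v ≠ v0}) Sum.inl_injective).ne_iff, map_zero,
    AlgHom.map_det, AlgHom.map_det]
  refine not_congr (Eq.congr (congrArg _ ?_) rfl)
  ext1 r c
  rcases r with e | v <;> rcases c with f | w
  · by_cases hK : e.1 ∈ K <;> by_cases hf : e.1 = (h.some f).1 <;>
      simp [bigMatrix, dodgsonLin, dodgsonConst, hK, hf]
    · rw [← hf]; simp [hK]
    · rw [← hf]; simp [hK]
  · simp only [bigMatrix, dodgsonLin, dodgsonConst, incCol]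
    simp only [AlgHom.mapMatrix_apply, Matrix.map_apply, Matrix.of_apply, Sum.map_inl, Sum.map_inr,
      id_eq]
    split_ifs <;> simp
  · simp only [bigMatrix, dodgsonLin, dodgsonConst, incCol]
    simp only [AlgHom.mapMatrix_apply, Matrix.map_apply, Matrix.of_apply, Sum.map_inl, Sum.map_inr,
      id_eq]
    split_ifs <;> simp
  · simp [bigMatrix, dodgsonLin, dodgsonConst]

lemma edgeVec_apply (e : G.E) (v : G.V) :
    G.edgeVec e v = (if G.src e = v then 1 else 0) - (if G.tgt e = v then 1 else 0) := by
  simp [edgeVec, Pi.single_apply, eq_comm]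

/-- The specialisation of a Dodgson matrix giving the coefficient of the monomial of `s`. -/
def dodgsonCoeff (v0 : G.V) (I J K : Set G.E) (φ : {e : G.E // e ∉ I} ≃ {e : G.E // e ∉ J})
    (s : Finset ({e : G.E // e ∉ I} ⊕ {v : G.V // v ≠ v0})) :
    Matrix ({e : G.E // e ∉ I} ⊕ {v : G.V // v ≠ v0})
      ({e : G.E // e ∉ I} ⊕ {v : G.V // v ≠ v0}) ℚ :=
  Matrix.of fun r c =>
    ((if r ∈ s then dodgsonLin v0 I J K φ r c else dodgsonConst v0 I J φ r c : ℤ) : ℚ)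

section kernel

open scoped Matrix

variable {v0 : G.V} {I J K : Set G.E} {φ : {e : G.E // e ∉ I} ≃ {e : G.E // e ∉ J}}
  {s : Finset ({e : G.E // e ∉ I} ⊕ {v : G.V // v ≠ v0})} {y : G.E → ℚ} {z : G.V → ℚ}

lemma sum_notMem_eq_sum (hy : ∀ e ∈ J, y e = 0) (g : G.E → ℚ) :
    ∑ c : {e : G.E // e ∉ I}, g (φ c).1 * y (φ c).1 = ∑ e, g e * y e := by
  rw [φ.sum_comp (fun c : {e : G.E // e ∉ J} => g c.1 * y c.1),
    ← Finset.sum_subtype (Finset.univ.filter (· ∉ J)) (by simp) fun e => g e * y e]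
  refine Finset.sum_subset (Finset.subset_univ _) fun e _ he => ?_
  rw [hy e (by simpa using he), mul_zero]

lemma sum_ne_eq_sum (hz : z v0 = 0) (g : G.V → ℚ) :
    ∑ v : {v : G.V // v ≠ v0}, g v.1 * z v.1 = ∑ v, g v * z v := by
  rw [← Finset.sum_subtype (Finset.univ.filter (· ≠ v0)) (by simp) fun v => g v * z v]
  refine Finset.sum_subset (Finset.subset_univ _) fun v _ hv => ?_
  rw [show v = v0 by simpa using hv, hz, mul_zero]

lemma dodgsonCoeff_mulVec_eq_zero_iff (hy : ∀ e ∈ J, y e = 0) (hz : z v0 = 0) :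
    dodgsonCoeff v0 I J K φ s *ᵥ Sum.elim (fun c => y (φ c).1) (fun v => z v.1) = 0 ↔
      (∀ e : {e : G.E // e ∉ I}, Sum.inl e ∈ s → e.1 ∉ K → y e.1 = 0) ∧
      (∀ e : {e : G.E // e ∉ I}, Sum.inl e ∉ s → z (G.src e) = z (G.tgt e)) ∧
      ∀ v : {v : G.V // v ≠ v0}, Sum.inr v ∉ s → (∑ e, y e • G.edgeVec e) v = 0 := by
  have hrow : ∀ r, (dodgsonCoeff v0 I J K φ s *ᵥ
      Sum.elim (fun c => y (φ c).1) (fun v => z v.1)) r =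
      Sum.elim
        (fun e => if Sum.inl e ∈ s then (if e.1 ∈ K then 0 else y e.1)
          else z (G.src e) - z (G.tgt e))
        (fun v => if Sum.inr v ∈ s then 0 else -(∑ e, y e • G.edgeVec e) v.1) r := by
    rintro (e | v)
    · by_cases hs : Sum.inl e ∈ s
      · have h1 := sum_notMem_eq_sum (φ := φ) hy
          (fun f => if e.1 = f ∧ e.1 ∉ K then 1 else 0)
        by_cases hK : e.1 ∈ K <;>
        simp_all [Matrix.mulVec, dotProduct, dodgsonCoeff, dodgsonLin]
      · have h1 := sum_ne_eq_sum hz (G.edgeVec e.1)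
        simp only [Matrix.mulVec, dotProduct, dodgsonCoeff, dodgsonConst, Fintype.sum_sum_type, hs,
          Matrix.of_apply, if_false, Sum.elim_inl, Sum.elim_inr, Int.cast_zero, zero_mul,
          Finset.sum_const_zero, zero_add]
        simp only [edgeVec_apply] at h1
        push_cast
        rw [h1]
        simp [sub_mul]
    · by_cases hs : Sum.inr v ∈ s
      · simp [Matrix.mulVec, dotProduct, dodgsonCoeff, dodgsonLin, hs]
      · have h1 := sum_notMem_eq_sum (φ := φ) hy (fun f => -G.edgeVec f v.1)
        simp only [Matrix.mulVec, dotProduct, dodgsonCoeff, dodgsonConst, Fintype.sum_sum_type, hs,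
          Matrix.of_apply, if_false, Sum.elim_inl, Sum.elim_inr, Int.cast_zero, zero_mul,
          Finset.sum_const_zero, add_zero]
        simp only [edgeVec_apply] at h1
        push_cast
        rw [h1]
        simp only [Finset.sum_apply, Pi.smul_apply, edgeVec_apply, smul_eq_mul,
          ← Finset.sum_neg_distrib]
        exact Finset.sum_congr rfl fun e _ => by ring
  constructor
  · intro h
    refine ⟨fun e hs hK => ?_, fun e hs => ?_, fun v hs => ?_⟩
    · simpa [hs, hK, h] using (hrow (Sum.inl e)).symm
    · simpa [hs, h, sub_eq_zero] using (hrow (Sum.inl e)).symm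
    · simpa only [hs, h, if_false, Sum.elim_inr, Pi.zero_apply, neg_eq_zero]
        using (hrow (Sum.inr v)).symm
  · rintro ⟨h1, h2, h3⟩
    funext r
    rw [hrow r]
    rcases r with e | v
    · by_cases hs : Sum.inl e ∈ s
      · by_cases hK : e.1 ∈ K
        · simp [hs, hK]
        · simp [hs, hK, h1 e hs hK]
      · simp [hs, h2 e hs]
    · by_cases hs : Sum.inr v ∈ s
      · simp [hs]
      · simp only [hs, h3 v hs, if_false, Sum.elim_inr, Pi.zero_apply, neg_zero]

lemma det_dodgsonCoeff_ne_zero_iff_forall :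
    (dodgsonCoeff v0 I J K φ s).det ≠ 0 ↔ ∀ (y : G.E → ℚ) (z : G.V → ℚ),
      (∀ e ∈ J, y e = 0) → z v0 = 0 →
      (∀ e : {e : G.E // e ∉ I}, Sum.inl e ∈ s → e.1 ∉ K → y e.1 = 0) →
      (∀ e : {e : G.E // e ∉ I}, Sum.inl e ∉ s → z (G.src e) = z (G.tgt e)) →
      (∀ v : {v : G.V // v ≠ v0}, Sum.inr v ∉ s → (∑ e, y e • G.edgeVec e) v = 0) →
      y = 0 ∧ z = 0 := by
  rw [Ne, ← Matrix.exists_mulVec_eq_zero_iff]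
  constructor
  · intro h y z hy hz h1 h2 h3
    by_contra hne
    refine h ⟨_, fun h0 => hne ?_, (dodgsonCoeff_mulVec_eq_zero_iff hy hz).2 ⟨h1, h2, h3⟩⟩
    constructor
    · funext e
      by_cases he : e ∈ J
      · exact hy e he
      · simpa using congrFun h0 (Sum.inl (φ.symm ⟨e, he⟩))
    · funext v
      by_cases hv : v = v0
      · rw [hv, hz]; rfl
      · simpa using congrFun h0 (Sum.inr ⟨v, hv⟩)
  · rintro h ⟨w, hw0, hw⟩
    set y : G.E → ℚ := fun e => if he : e ∉ J then w (Sum.inl (φ.symm ⟨e, he⟩)) else 0 with hydef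
    set z : G.V → ℚ := fun v => if hv : v ≠ v0 then w (Sum.inr ⟨v, hv⟩) else 0 with hzdef
    have hy : ∀ e ∈ J, y e = 0 := fun e he => by simp [hydef, he]
    have hz : z v0 = 0 := by simp [hzdef]
    have hwe : w = Sum.elim (fun c => y (φ c).1) (fun v => z v.1) := by
      funext r
      rcases r with e | v
      · simp [hydef, (φ e).2]
      · simp [hzdef, v.2]
    rw [hwe, dodgsonCoeff_mulVec_eq_zero_iff hy hz] at hw
    obtain ⟨h1, h2⟩ := h y z hy hz hw.1 hw.2.1 hw.2.2
    refine hw0 (hwe.trans ?_)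
    funext r
    rcases r with e | v <;> simp [h1, h2]

lemma inl_notMem_of_det_dodgsonCoeff_ne_zero (h : (dodgsonCoeff v0 I J K φ s).det ≠ 0)
    {e : {e : G.E // e ∉ I}} (he : e.1 ∈ J ∪ K) : Sum.inl e ∉ s := by
  refine fun hs => h (Matrix.det_eq_zero_of_row_eq_zero (Sum.inl e) ?_)
  rintro (f | v)
  · have h2 : ¬(e.1 = (φ f).1 ∧ e.1 ∉ K) := by
      rintro ⟨h1, h2⟩
      exact (φ f).2 (h1 ▸ he.resolve_right h2)
    simp only [dodgsonCoeff, dodgsonLin, Matrix.of_apply, hs, if_true, if_neg h2, Int.cast_zero]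
  · simp [dodgsonCoeff, dodgsonLin, hs]

lemma inr_notMem_of_det_dodgsonCoeff_ne_zero (h : (dodgsonCoeff v0 I J K φ s).det ≠ 0)
    (v : {v : G.V // v ≠ v0}) : Sum.inr v ∉ s := by
  refine fun hs => h (Matrix.det_eq_zero_of_row_eq_zero (Sum.inr v) ?_)
  rintro (f | v) <;> simp [dodgsonCoeff, dodgsonLin, hs]

lemma sum_edgeVec_eq_zero_of_forall_ne
    (h : ∀ v : {v : G.V // v ≠ v0}, (∑ e, y e • G.edgeVec e) v = 0) :
    ∑ e, y e • G.edgeVec e = 0 := by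
  have hs : ∑ v, (∑ e, y e • G.edgeVec e) v = 0 := by
    simp only [Finset.sum_apply]
    rw [Finset.sum_comm]
    refine Finset.sum_eq_zero fun e _ => ?_
    simp [edgeVec_apply, ← Finset.mul_sum]
  rw [Fintype.sum_eq_single v0 (fun v hv => h ⟨v, hv⟩)] at hs
  funext v
  by_cases hv : v = v0
  · rw [hv, hs]; rfl
  · exact h ⟨v, hv⟩

end kernel

/-- A Dodgson polynomial is nonzero exactly when the complement of some set `U` of edges is, after
removing `I`, connected and spanning, and, after removing `J`, a forest. -/
lemma dodgson_ne_zero_iff (v0 : G.V) {I J : Set G.E} (K : Set G.E) (hIJ : I.ncard = J.ncard) :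
    G.dodgson v0 I J K ≠ 0 ↔ ∃ U : Set G.E, Disjoint U (I ∪ J ∪ K) ∧
      Fintype.card G.V ≤ G.linRank (I ∪ U)ᶜ + 1 ∧
      G.linRank (J ∪ U)ᶜ = ((J ∪ U)ᶜ).ncard := by
  have : Nonempty G.V := ⟨v0⟩
  have hφ : Nonempty ({e : G.E // e ∉ I} ≃ {e : G.E // e ∉ J}) := by
    refine ⟨Fintype.equivOfCardEq ?_⟩
    rw [← Nat.card_eq_fintype_card, ← Nat.card_eq_fintype_card]
    have h1 := Set.ncard_add_ncard_compl I
    have h2 := Set.ncard_add_ncard_compl J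
    change Nat.card (Iᶜ : Set G.E) = Nat.card (Jᶜ : Set G.E)
    rw [Nat.card_coe_set_eq, Nat.card_coe_set_eq]
    omega
  have hcast : ∀ s, Matrix.det (Matrix.of fun r c => if r ∈ s then dodgsonLin v0 I J K hφ.some r c
      else dodgsonConst v0 I J hφ.some r c) ≠ 0 ↔ (dodgsonCoeff v0 I J K hφ.some s).det ≠ 0 := by
    intro s
    rw [← Int.cast_ne_zero (α := ℚ), Int.cast_det]
    rfl
  rw [dodgson_ne_zero_iff_exists_det v0 K hφ]
  simp only [hcast, linRank_eq_ncard_iff, card_le_linRank_add_one_iff]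
  constructor
  · rintro ⟨s, hs⟩
    have hJK := fun e he => inl_notMem_of_det_dodgsonCoeff_ne_zero hs (e := e) he
    have hV := inr_notMem_of_det_dodgsonCoeff_ne_zero hs
    rw [det_dodgsonCoeff_ne_zero_iff_forall] at hs
    refine ⟨{e | ∃ h : e ∉ I, Sum.inl ⟨e, h⟩ ∈ s}, ?_, fun z hz v w => ?_, fun y hy hsum => ?_⟩
    · rw [Set.disjoint_left]
      rintro e ⟨h, hes⟩ ((h1 | h1) | h1)
      · exact h h1
      · exact hJK _ (Or.inl h1) hes
      · exact hJK _ (Or.inr h1) hes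
    · have h2 := (hs 0 (fun u => z u - z v0) (fun _ _ => rfl) (sub_self _) (fun _ _ _ => rfl)
        (fun e he => ?_) (fun _ _ => by simp)).2
      · have h3 := congrFun h2 v
        have h4 := congrFun h2 w
        simp only [Pi.zero_apply, sub_eq_zero] at h3 h4
        rw [h3, h4]
      · have := hz e.1 (by
          rintro (h | ⟨h, h'⟩)
          · exact e.2 h
          · exact he h')
        simp only [this]
    · refine (hs y 0 (fun e he => hy e fun h => h (Or.inl he)) rfl (fun e he _ => hy _ fun h =>
        h (Or.inr ⟨e.2, he⟩)) (fun _ _ => rfl) (fun v _ => by rw [hsum]; rfl)).1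
  · rintro ⟨U, hU, hz, hy⟩
    refine ⟨Finset.univ.filter fun r => ∃ e : {e : G.E // e ∉ I}, e.1 ∈ U ∧ r = Sum.inl e,
      det_dodgsonCoeff_ne_zero_iff_forall.2 fun y z hyJ hz0 h1 h2 h3 => ⟨?_, ?_⟩⟩
    · refine hy y (fun e he => ?_) (sum_edgeVec_eq_zero_of_forall_ne fun v => h3 v (by simp))
      by_cases heJ : e ∈ J
      · exact hyJ e heJ
      · have heU : e ∈ U := by simpa [heJ] using he
        have := Set.disjoint_left.1 hU heU
        have heI : e ∉ I := fun h => this (Or.inl (Or.inl h))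
        exact h1 ⟨e, heI⟩ (by simp [heU, heI]) fun h => this (Or.inr h)
    · funext v
      refine (hz z (fun e he => ?_) v v0).trans hz0
      simp only [Set.mem_compl_iff, Set.mem_union, not_or] at he
      exact h2 ⟨e, he.1⟩ (by simp [he.2])

/-- A partition of `S` into two pairs `A`, `B` and one further edge, to be deleted (`D`) or
contracted (`C`). -/
structure IsConfigPartition (S A B D C : Set G.E) : Prop where
  union_eq : A ∪ B ∪ (D ∪ C) = S
  disjAB : Disjoint A B
  disjA : Disjoint A (D ∪ C)
  disjB : Disjoint B (D ∪ C)
  cardA : A.ncard = 2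
  cardB : B.ncard = 2
  single : ∃ e, (D = {e} ∧ C = ∅) ∨ (D = ∅ ∧ C = {e})

lemma IsConfigPartition.disjDC {S A B D C : Set G.E} (h : IsConfigPartition S A B D C) :
    Disjoint D C := by
  obtain ⟨e, ⟨-, rfl⟩ | ⟨rfl, -⟩⟩ := h.single <;> simp

lemma IsConfigPartition.dodgson_ne_zero_iff {S A B D C : Set G.E}
    (h : IsConfigPartition S A B D C) (v0 : G.V) :
    G.dodgson v0 (D ∪ A) (D ∪ B) C ≠ 0 ↔ ∃ T : Set G.E, Disjoint T S ∧
      Fintype.card G.V ≤ G.linRank (T ∪ (B ∪ C)) + 1 ∧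
      G.linRank (T ∪ (A ∪ C)) = (T ∪ (A ∪ C)).ncard := by
  have hDC := h.disjDC
  obtain ⟨hS, hAB, hA, hB, hcA, hcB, -⟩ := h
  rw [Set.disjoint_left] at hDC hAB hA hB
  have hc : (D ∪ A).ncard = (D ∪ B).ncard := by
    rw [Set.ncard_union_eq (Set.disjoint_left.2 fun e h1 h2 => hA h2 (Or.inl h1)),
      Set.ncard_union_eq (Set.disjoint_left.2 fun e h1 h2 => hB h2 (Or.inl h1)), hcA, hcB]
  have hS' : D ∪ A ∪ (D ∪ B) ∪ C = S := by
    rw [← hS]; ext e; simp only [Set.mem_union]; tauto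
  rw [Multigraph.dodgson_ne_zero_iff v0 C hc, hS']
  have h1 : ∀ U T : Set G.E, (∀ e, e ∈ T ↔ e ∉ S ∧ e ∉ U) →
      (∀ e ∈ U, e ∉ S) → (D ∪ A ∪ U)ᶜ = T ∪ (B ∪ C) ∧ (D ∪ B ∪ U)ᶜ = T ∪ (A ∪ C) := by
    intro U T hT hU
    have hS2 : ∀ e, e ∈ S ↔ e ∈ A ∨ e ∈ B ∨ e ∈ D ∨ e ∈ C := by
      intro e; rw [← hS]; simp only [Set.mem_union]; tauto
    constructor
    all_goals
      ext e
      specialize hS2 e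
      specialize hT e
      specialize hU e
      specialize @hDC e
      specialize @hAB e
      specialize @hA e
      specialize @hB e
      simp only [Set.mem_compl_iff, Set.mem_union] at *
      grind only
  constructor
  · rintro ⟨U, hU, h2, h3⟩
    rw [Set.disjoint_left] at hU
    obtain ⟨h4, h5⟩ := h1 U (S ∪ U)ᶜ (by simp) (fun e he => hU he)
    rw [h4] at h2
    rw [h5] at h3
    exact ⟨(S ∪ U)ᶜ, Set.disjoint_left.2 fun e he h => he (Or.inl h), h2, h3⟩
  · rintro ⟨T, hT, h2, h3⟩
    rw [Set.disjoint_left] at hT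
    obtain ⟨h4, h5⟩ := h1 (S ∪ T)ᶜ T (fun e => by
      have := @hT e
      simp only [Set.mem_compl_iff, Set.mem_union]; tauto) (fun e he h => he (Or.inl h))
    rw [← h4] at h2
    rw [← h5] at h3
    exact ⟨(S ∪ T)ᶜ, Set.disjoint_left.2 fun e he h => he (Or.inl h), h2, h3⟩

lemma configSplits_iff [Nonempty G.V] (S : Set G.E) :
    G.ConfigSplits S ↔ ∃ A B D C, IsConfigPartition S A B D C ∧ ∀ T : Set G.E, Disjoint T S →
      Fintype.card G.V ≤ G.linRank (T ∪ (B ∪ C)) + 1 →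
      G.linRank (T ∪ (A ∪ C)) = (T ∪ (A ∪ C)).ncard → False := by
  constructor
  · rintro ⟨I, J, K, ⟨hS, hcase⟩, hzero⟩
    have hP : IsConfigPartition S (I \ J) (J \ I) (I ∩ J) K := by
      have hu : I \ J ∪ J \ I ∪ (I ∩ J ∪ K) = S := by
        rw [← hS]; ext e; simp only [Set.mem_union, Set.mem_sdiff, Set.mem_inter_iff]; tauto
      have hI := Set.ncard_inter_add_ncard_sdiff_eq_ncard I J
      have hJ := Set.ncard_inter_add_ncard_sdiff_eq_ncard J I
      rw [Set.inter_comm J I] at hJ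
      rcases hcase with ⟨h1, h2, h3, h4, h5, h6⟩ | ⟨h1, h2, h3, h4⟩
      · rw [h4] at hI hJ
        rw [Set.ncard_empty] at hI hJ
        obtain ⟨e, rfl⟩ := Set.ncard_eq_one.1 h3
        refine ⟨hu, ?_, ?_, ?_, by omega, by omega, e, Or.inr ⟨h4, rfl⟩⟩
        all_goals
          rw [Set.disjoint_left]
          intro f
          have := Set.ext_iff.1 h5 f
          have := Set.ext_iff.1 h6 f
          simp only [Set.mem_union, Set.mem_sdiff, Set.mem_inter_iff, Set.mem_empty_iff_false] at *
          tauto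
      · obtain ⟨e, he⟩ := Set.ncard_eq_one.1 h4
        refine ⟨hu, ?_, ?_, ?_, by omega, by omega, e, Or.inl ⟨he, h3⟩⟩
        all_goals
          rw [Set.disjoint_left]
          intro f
          simp only [h3, Set.mem_union, Set.mem_sdiff, Set.mem_inter_iff,
            Set.mem_empty_iff_false] at *
          tauto
    refine ⟨_, _, _, _, hP, fun T h1 h2 h3 => ?_⟩
    have h4 := (hP.dodgson_ne_zero_iff (Classical.arbitrary G.V)).2 ⟨T, h1, h2, h3⟩
    rw [Set.inter_union_sdiff, Set.inter_comm, Set.inter_union_sdiff] at h4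
    exact h4 (hzero _)
  · rintro ⟨A, B, D, C, hP, hT⟩
    refine ⟨D ∪ A, D ∪ B, C, ⟨?_, ?_⟩, fun v0 => ?_⟩
    · rw [← hP.union_eq]; ext e; simp only [Set.mem_union]; tauto
    · have hAB := Set.disjoint_left.1 hP.disjAB
      have hA := Set.disjoint_left.1 hP.disjA
      have hB := Set.disjoint_left.1 hP.disjB
      have h3 : (D ∪ A).ncard = D.ncard + 2 := by
        rw [Set.ncard_union_eq (Set.disjoint_left.2 fun e h1 h2 => hA h2 (Or.inl h1)), hP.cardA]
      have h4 : (D ∪ B).ncard = D.ncard + 2 := by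
        rw [Set.ncard_union_eq (Set.disjoint_left.2 fun e h1 h2 => hB h2 (Or.inl h1)), hP.cardB]
      have h5 : (D ∪ A) ∩ (D ∪ B) = D := by
        rw [← Set.union_inter_distrib_left, Set.disjoint_iff_inter_eq_empty.1 hP.disjAB,
          Set.union_empty]
      obtain ⟨e, ⟨h1, h2⟩ | ⟨h1, h2⟩⟩ := hP.single
      · right
        rw [h3, h4, h5, h1]
        simp [h2]
      · left
        rw [h3, h4, h5]
        refine ⟨by simp [h1], by simp [h1], by simp [h2], h1, ?_, ?_⟩
        · rw [h1, Set.empty_union, ← Set.disjoint_iff_inter_eq_empty]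
          exact hP.disjA.mono_right Set.subset_union_right
        · rw [h1, Set.empty_union, ← Set.disjoint_iff_inter_eq_empty]
          exact hP.disjB.mono_right Set.subset_union_right
    · by_contra hne
      obtain ⟨T, h1, h2, h3⟩ := (hP.dodgson_ne_zero_iff v0).1 hne
      exact hT T h1 h2 h3

lemma linRank_eq_ncard_of_subset {X Y : Set G.E} (h : X ⊆ Y) (hY : G.linRank Y = Y.ncard) :
    G.linRank X = X.ncard := by
  have h1 := linRank_union_le X (Y \ X)
  rw [Set.union_sdiff_cancel h] at h1
  have h2 := linRank_le_ncard (Y \ X)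
  have h3 := Set.ncard_sdiff_add_ncard_of_subset h
  have h4 := linRank_le_ncard X
  omega

lemma IsConfigPartition.no_common_basis [Nonempty G.V] {S A B D C E₁ E₂ T : Set G.E}
    (hP : IsConfigPartition S A B D C) (hE : Disjoint E₁ E₂) (hun : E₁ ∪ E₂ = (D ∪ C)ᶜ)
    (hB : B ⊆ E₂)
    (hr : G.linRank (E₁ ∪ C) + G.linRank (E₂ ∪ C) + 2 ≤
      Fintype.card G.V + C.ncard + (A ∩ E₁).ncard)
    (hT : Disjoint T S) (hsp : Fintype.card G.V ≤ G.linRank (T ∪ (B ∪ C)) + 1)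
    (hind : G.linRank (T ∪ (A ∪ C)) = (T ∪ (A ∪ C)).ncard) : False := by
  have hS : ∀ X : Set G.E, X ⊆ S → Disjoint T X := fun X hX => hT.mono_right hX
  have hAS : A ⊆ S := by rw [← hP.union_eq]; exact fun e he => Or.inl (Or.inl he)
  have hBS : B ⊆ S := by rw [← hP.union_eq]; exact fun e he => Or.inl (Or.inr he)
  have hCS : C ⊆ S := by rw [← hP.union_eq]; exact fun e he => Or.inr (Or.inr he)
  have hDS : D ⊆ S := by rw [← hP.union_eq]; exact fun e he => Or.inr (Or.inl he)
  have hAC : Disjoint A C := hP.disjA.mono_right Set.subset_union_right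
  have hBC : Disjoint B C := hP.disjB.mono_right Set.subset_union_right
  have c1 : (T ∪ (A ∪ C)).ncard = T.ncard + (2 + C.ncard) := by
    rw [Set.ncard_union_eq (hS _ (Set.union_subset hAS hCS)), Set.ncard_union_eq hAC, hP.cardA]
  have c2 : (T ∪ (B ∪ C)).ncard = T.ncard + (2 + C.ncard) := by
    rw [Set.ncard_union_eq (hS _ (Set.union_subset hBS hCS)), Set.ncard_union_eq hBC, hP.cardB]
  have r1 := linRank_add_one_le_card (T ∪ (A ∪ C))
  have r2 := linRank_le_ncard (T ∪ (B ∪ C))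
  have hindB : G.linRank (T ∪ (B ∪ C)) = (T ∪ (B ∪ C)).ncard := by omega
  have s1 : (T ∩ E₁) ∪ (A ∩ E₁ ∪ C) ⊆ T ∪ (A ∪ C) :=
    Set.union_subset_union Set.inter_subset_left
      (Set.union_subset_union_left _ Set.inter_subset_left)
  have s2 : (T ∩ E₂) ∪ (B ∪ C) ⊆ T ∪ (B ∪ C) :=
    Set.union_subset_union_left _ Set.inter_subset_left
  have i1 := linRank_eq_ncard_of_subset s1 hind
  have i2 := linRank_eq_ncard_of_subset s2 hindB
  have m1 : G.linRank ((T ∩ E₁) ∪ (A ∩ E₁ ∪ C)) ≤ G.linRank (E₁ ∪ C) :=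
    linRank_mono (Set.union_subset (fun e he => Or.inl he.2)
      (Set.union_subset_union_left _ Set.inter_subset_right))
  have m2 : G.linRank ((T ∩ E₂) ∪ (B ∪ C)) ≤ G.linRank (E₂ ∪ C) :=
    linRank_mono (Set.union_subset (fun e he => Or.inl he.2) (Set.union_subset_union_left _ hB))
  have c3 : ((T ∩ E₁) ∪ (A ∩ E₁ ∪ C)).ncard = (T ∩ E₁).ncard + ((A ∩ E₁).ncard + C.ncard) := by
    rw [Set.ncard_union_eq
      ((hS _ (Set.union_subset (Set.inter_subset_left.trans hAS) hCS)).mono_left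
      Set.inter_subset_left), Set.ncard_union_eq (hAC.mono_left Set.inter_subset_left)]
  have c4 : ((T ∩ E₂) ∪ (B ∪ C)).ncard = (T ∩ E₂).ncard + (2 + C.ncard) := by
    rw [Set.ncard_union_eq ((hS _ (Set.union_subset hBS hCS)).mono_left Set.inter_subset_left),
      Set.ncard_union_eq hBC, hP.cardB]
  have c5 : (T ∩ E₁).ncard + (T ∩ E₂).ncard = T.ncard := by
    rw [← Set.ncard_union_eq (hE.mono Set.inter_subset_right Set.inter_subset_right),
      ← Set.inter_union_distrib_left, hun, Set.inter_eq_left.2]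
    exact fun e he h => Set.disjoint_left.1 hT he (Set.union_subset hDS hCS h)
  omega

lemma configSplits_of_splitWitness [Nonempty G.V] {S D C : Set G.E} (hS : S.ncard = 5)
    (hDC : D ∪ C ⊆ S) (hsingle : ∃ e, (D = {e} ∧ C = ∅) ∨ (D = ∅ ∧ C = {e}))
    (h : (G.minorDC D C).splitWitness {f | f.1 ∈ S}) : G.ConfigSplits S := by
  rw [configSplits_iff]
  obtain ⟨U₁, U₂, F₁, F₂, hF₁, hF₂, hdisj, hU, hF, hcase⟩ := h
  set E₁ := minorVal D C '' F₁ with hE₁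
  set E₂ := minorVal D C '' F₂ with hE₂
  have hE : Disjoint E₁ E₂ := (Set.disjoint_image_iff (minorVal_injective D C)).2 hdisj
  have hun : E₁ ∪ E₂ = (D ∪ C)ᶜ := by
    rw [← Set.image_union, hF, Set.image_univ, range_minorVal]
  have hcard1 : (F₁ ∩ {f | f.1 ∈ S}).ncard = (E₁ ∩ S).ncard := by
    rw [← Set.ncard_image_of_injective _ (minorVal_injective D C)]
    congr 1
    ext e
    simp only [hE₁, Set.mem_image, Set.mem_inter_iff]
    constructor
    · rintro ⟨f, ⟨h1, h2⟩, rfl⟩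
      exact ⟨⟨f, h1, rfl⟩, h2⟩
    · rintro ⟨⟨f, h1, rfl⟩, h2⟩
      exact ⟨f, ⟨h1, h2⟩, rfl⟩
  rw [hcard1] at hcase
  have hDCcard : (D ∪ C).ncard = 1 := by
    obtain ⟨e, ⟨rfl, rfl⟩ | ⟨rfl, rfl⟩⟩ := hsingle <;> simp
  have hcard : (E₁ ∩ S).ncard + (E₂ ∩ S).ncard = 4 := by
    rw [← Set.ncard_union_eq (hE.mono Set.inter_subset_left Set.inter_subset_left),
      ← Set.union_inter_distrib_right, hun, Set.inter_comm, ← Set.sdiff_eq]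
    have := Set.ncard_sdiff_add_ncard_of_subset hDC
    omega
  have hne1 : (E₁ ∩ S).Nonempty := (Set.ncard_pos (Set.toFinite _)).1 (by omega)
  have hne2 : (E₂ ∩ S).Nonempty := (Set.ncard_pos (Set.toFinite _)).1 (by omega)
  obtain ⟨_, ⟨f₁, hf₁, -⟩, -⟩ := hne1
  obtain ⟨_, ⟨f₂, hf₂, -⟩, -⟩ := hne2
  have r1 := linRank_add_one_le hF₁ ⟨_, (hF₁ f₁ hf₁).1⟩
  have r2 := linRank_add_one_le hF₂ ⟨_, (hF₂ f₂ hf₂).1⟩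
  have l1 := linRank_minor_add D C F₁
  have l2 := linRank_minor_add D C F₂
  rw [← hE₁] at l1
  rw [← hE₂] at l2
  have l3 := card_minor_add D C
  have l4 := Set.ncard_union_add_ncard_inter U₁ U₂
  rw [hU, Set.ncard_univ, Nat.card_eq_fintype_card] at l4
  have l5 := linRank_le_ncard C
  have hdE : ∀ X : Set G.E, X ⊆ E₁ ∪ E₂ → Disjoint X (D ∪ C) := fun X hX =>
    Set.disjoint_left.2 fun e he => (hun ▸ hX he : e ∈ (D ∪ C)ᶜ)
  have hSu : E₁ ∩ S ∪ E₂ ∩ S ∪ (D ∪ C) = S := by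
    rw [← Set.union_inter_distrib_right, hun]
    ext e
    have := @hDC e
    simp only [Set.mem_union, Set.mem_inter_iff, Set.mem_compl_iff] at *
    tauto
  rcases hcase with ⟨hk, hc⟩ | ⟨hk, hc⟩
  · have hP : IsConfigPartition S (E₁ ∩ S) (E₂ ∩ S) D C :=
      ⟨hSu, hE.mono Set.inter_subset_left Set.inter_subset_left,
        hdE _ (fun e he => Or.inl he.1), hdE _ (fun e he => Or.inr he.1), hc, by omega, hsingle⟩
    refine ⟨_, _, _, _, hP, fun T => hP.no_common_basis hE hun Set.inter_subset_left ?_⟩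
    rw [Set.inter_eq_left.2 Set.inter_subset_left]
    omega
  · obtain ⟨b, hb⟩ : (E₂ ∩ S).Nonempty := (Set.ncard_pos (Set.toFinite _)).1 (by omega)
    have hb₁ : b ∉ E₁ := fun h => Set.disjoint_left.1 hE h hb.1
    have hP : IsConfigPartition S (insert b (E₁ ∩ S)) ((E₂ ∩ S) \ {b}) D C := by
      refine ⟨?_, ?_, hdE _ (Set.insert_subset (Or.inr hb.1) fun e he => Or.inl he.1),
        hdE _ (fun e he => Or.inr he.1.1), ?_, ?_, hsingle⟩
      · rw [Set.insert_union, ← Set.union_insert, Set.insert_sdiff_singleton,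
          Set.insert_eq_of_mem hb, hSu]
      · rw [Set.disjoint_left]
        rintro e (rfl | he) h
        · exact h.2 rfl
        · exact Set.disjoint_left.1 hE he.1 h.1.1
      · rw [Set.ncard_insert_of_notMem (fun h => hb₁ h.1), hc]
      · rw [Set.ncard_sdiff_singleton_of_mem hb]
        omega
    refine ⟨_, _, _, _, hP, fun T => hP.no_common_basis hE hun (fun e he => he.1.1) ?_⟩
    rw [Set.insert_inter_of_notMem hb₁, Set.inter_eq_left.2 Set.inter_subset_left]
    omega

lemma Connected.nonempty (hG : G.Connected) : Nonempty G.V :=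
  let ⟨v, _⟩ := hG.1
  ⟨v⟩

lemma Connected.card_le_linRank_add_one (hG : G.Connected) :
    Fintype.card G.V ≤ G.linRank Set.univ + 1 := by
  have := hG.nonempty
  rw [card_le_linRank_add_one_iff]
  intro z hz v w
  induction hG.2 v trivial w trivial with
  | refl => rfl
  | tail _ hstep ih =>
    obtain ⟨-, -, e, -, ⟨rfl, rfl⟩ | ⟨rfl, rfl⟩⟩ := hstep
    · exact ih.trans (hz e trivial)
    · exact ih.trans (hz e trivial).symm

lemma splitWitness_delete {S : Set G.E} {f : G.E} {U₁ U₂ : Set G.V} {F : Set G.E}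
    (hF : G.IsSubgraphPair U₁ (F \ {f})) (hF' : G.IsSubgraphPair U₂ (Fᶜ \ {f}))
    (hU : U₁ ∪ U₂ = Set.univ)
    (h : ((U₁ ∩ U₂).ncard ≤ 2 ∧ ((F ∩ S) \ {f}).ncard = 2) ∨
      ((U₁ ∩ U₂).ncard = 1 ∧ ((F ∩ S) \ {f}).ncard = 1)) :
    (G.minorDC {f} ∅).splitWitness {g | g.1 ∈ S} := by
  have hval : ∀ g : (G.minorDC {f} ∅).E, minorVal {f} ∅ g ≠ f := by
    intro g hg
    exact g.2 (Or.inl hg)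
  refine ⟨minorMk {f} ∅ '' U₁, minorMk {f} ∅ '' U₂, minorVal {f} ∅ ⁻¹' F, minorVal {f} ∅ ⁻¹' Fᶜ,
    fun g hg => ?_, fun g hg => ?_, disjoint_compl_right, ?_, ?_, ?_⟩
  · obtain ⟨h1, h2⟩ := hF _ ⟨hg, hval g⟩
    exact ⟨⟨_, h1, rfl⟩, ⟨_, h2, rfl⟩⟩
  · obtain ⟨h1, h2⟩ := hF' _ ⟨hg, hval g⟩
    exact ⟨⟨_, h1, rfl⟩, ⟨_, h2, rfl⟩⟩
  · rw [← Set.image_union, hU, Set.image_univ, (minorMk_surjective {f} ∅).range_eq]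
  · rw [← Set.preimage_union, Set.union_compl_self, Set.preimage_univ]
  · rw [← Set.image_inter (minorMk_empty_injective {f}),
      Set.ncard_image_of_injective _ (minorMk_empty_injective {f}),
      ← Set.ncard_image_of_injective _ (minorVal_injective {f} ∅)]
    have himg : minorVal {f} ∅ '' (minorVal {f} ∅ ⁻¹' F ∩ {g | g.1 ∈ S}) = (F ∩ S) \ {f} := by
      ext e
      constructor
      · rintro ⟨g, ⟨h1, h2⟩, rfl⟩
        exact ⟨⟨h1, h2⟩, hval g⟩
      · rintro ⟨⟨h1, h2⟩, h3⟩
        have h4 : e ∉ ({f} ∪ ∅ : Set G.E) := by rwa [Set.union_empty]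
        exact ⟨⟨e, h4⟩, ⟨h1, h2⟩, rfl⟩
    rwa [himg]

lemma exists_splitWitness_of_loop {S : Set G.E} (hS : S.ncard = 5) {e : G.E} (he : e ∈ S)
    (hloop : G.linRank {e} = 0) : ∃ f ∈ S, (G.minorDC {f} ∅).splitWitness {g | g.1 ∈ S} := by
  obtain ⟨f, hf, hfe⟩ := Set.exists_ne_of_one_lt_ncard (s := S) (by omega) e
  have hends : G.src e = G.tgt e := by
    by_contra hne
    rw [linRank, Submodule.finrank_eq_zero] at hloop
    have h0 : G.edgeVec e ∈ G.edgeSpan {e} := edgeVec_mem_edgeSpan rfl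
    rw [hloop, Submodule.mem_bot] at h0
    have := congrFun h0 (G.src e)
    simp [edgeVec_apply, Ne.symm hne] at this
  refine ⟨f, hf, splitWitness_delete (U₁ := {G.src e}) (U₂ := Set.univ) (F := {e}) ?_
    (fun _ _ => ⟨trivial, trivial⟩) (Set.union_univ _) (Or.inr ⟨by simp, ?_⟩)⟩
  · rintro g ⟨rfl, -⟩
    exact ⟨rfl, hends.symm⟩
  · rw [Set.inter_eq_left.2 (Set.singleton_subset_iff.2 he),
      Set.sdiff_singleton_eq_self (by simpa using hfe), Set.ncard_singleton]

lemma exists_splitWitness_of_cut {S : Set G.E} (hS : S.ncard = 5) {e : G.E} (he : e ∈ S)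
    {W : Set G.V} (hW : W.Nonempty) (hcut : ∀ g ≠ e, G.src g ∈ W ↔ G.tgt g ∈ W)
    (hcross : G.src e ∈ W ↔ G.tgt e ∉ W)
    (hn : (({g | G.src g ∈ W} ∩ S) \ {e}).ncard ≤ 2) :
    ∃ f ∈ S, (G.minorDC {f} ∅).splitWitness {g | g.1 ∈ S} := by
  obtain h0 | h1 | h2 : (({g | G.src g ∈ W} ∩ S) \ {e}).ncard = 0 ∨
    (({g | G.src g ∈ W} ∩ S) \ {e}).ncard = 1 ∨ (({g | G.src g ∈ W} ∩ S) \ {e}).ncard = 2 := by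
    omega
  · obtain ⟨f, hf, hfe⟩ := Set.exists_ne_of_one_lt_ncard (s := S) (by omega) e
    rw [Set.ncard_eq_zero (Set.toFinite _)] at h0
    refine ⟨f, hf, splitWitness_delete (U₁ := W ∪ {G.src e, G.tgt e}) (U₂ := Wᶜ)
      (F := insert e {g | G.src g ∈ W}) ?_ ?_ ?_ (Or.inr ⟨?_, ?_⟩)⟩
    · rintro g ⟨hg | hg, -⟩
      · subst hg; simp
      · by_cases hge : g = e
        · subst hge; simp
        · exact ⟨Or.inl hg, Or.inl ((hcut g hge).1 hg)⟩
    · rintro g ⟨hg, -⟩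
      rw [Set.mem_compl_iff, Set.mem_insert_iff, not_or] at hg
      exact ⟨hg.2, fun h => hg.2 ((hcut g hg.1).2 h)⟩
    · rw [Set.union_right_comm, Set.union_compl_self, Set.univ_union]
    · rw [Set.ncard_eq_one]
      by_cases hs : G.src e ∈ W
      · refine ⟨G.tgt e, ?_⟩
        ext v
        simp only [Set.mem_inter_iff, Set.mem_union, Set.mem_insert_iff, Set.mem_singleton_iff,
          Set.mem_compl_iff]
        grind
      · refine ⟨G.src e, ?_⟩
        ext v
        simp only [Set.mem_inter_iff, Set.mem_union, Set.mem_insert_iff, Set.mem_singleton_iff,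
          Set.mem_compl_iff]
        grind
    · rw [Set.ncard_eq_one]
      refine ⟨e, ?_⟩
      ext g
      have := Set.ext_iff.1 h0 g
      simp only [Set.mem_inter_iff, Set.mem_sdiff, Set.mem_insert_iff, Set.mem_singleton_iff,
        Set.mem_ofPred_eq, Set.mem_empty_iff_false] at *
      grind
  · obtain ⟨w, hw⟩ := hW
    refine ⟨e, he, splitWitness_delete (U₁ := W) (U₂ := insert w Wᶜ)
      (F := {g | G.src g ∈ W}) ?_ ?_ ?_ (Or.inr ⟨?_, h1⟩)⟩
    · exact fun g hg => ⟨hg.1, (hcut g hg.2).1 hg.1⟩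
    · exact fun g hg => ⟨Or.inr hg.1, Or.inr fun h => hg.1 ((hcut g hg.2).2 h)⟩
    · rw [Set.union_insert, Set.union_compl_self, Set.insert_eq_of_mem (Set.mem_univ _)]
    · rw [Set.inter_insert_of_mem hw, Set.inter_compl_self]
      simp
  · refine ⟨e, he, splitWitness_delete (U₁ := W) (U₂ := Wᶜ)
      (F := {g | G.src g ∈ W}) ?_ ?_ (Set.union_compl_self W) (Or.inl ⟨by simp, h2⟩)⟩
    · exact fun g hg => ⟨hg.1, (hcut g hg.2).1 hg.1⟩
    · exact fun g hg => ⟨hg.1, fun h => hg.1 ((hcut g hg.2).2 h)⟩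

lemma exists_splitWitness_of_bridge (hG : G.Connected) {S : Set G.E} (hS : S.ncard = 5) {e : G.E}
    (he : e ∈ S) (hbridge : G.linRank {e}ᶜ + 1 < Fintype.card G.V) :
    ∃ f ∈ S, (G.minorDC {f} ∅).splitWitness {g | g.1 ∈ S} := by
  have := hG.nonempty
  obtain ⟨W, -, hWne, hWuniv, hcr⟩ := exists_uncrossed (F := {e}ᶜ) (U := Set.univ)
    Set.univ_nonempty (by rwa [Set.ncard_univ, Nat.card_eq_fintype_card])
  have hcut : ∀ g ≠ e, G.src g ∈ W ↔ G.tgt g ∈ W := by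
    intro g hg
    have := hcr g hg
    simp only [crossEdges, Set.mem_ofPred_eq, Set.mem_sdiff, Set.mem_univ, true_and] at this
    tauto
  obtain ⟨b, hb⟩ := (Set.ne_univ_iff_exists_notMem W).1 hWuniv
  have hcross : G.src e ∈ W ↔ G.tgt e ∉ W := by
    by_contra hne
    have hall : ∀ g, G.src g ∈ W ↔ G.tgt g ∈ W := by
      intro g
      by_cases hge : g = e
      · subst hge; tauto
      · exact hcut g hge
    obtain ⟨a, ha⟩ := hWne
    have := (card_le_linRank_add_one_iff _).1 hG.card_le_linRank_add_one (W.indicator 1)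
      (fun g _ => by simp only [Set.indicator, hall g, Pi.one_apply]) a b
    simp [ha, hb] at this
  have hsum : (({g | G.src g ∈ W} ∩ S) \ {e}).ncard +
      (({g | G.src g ∈ Wᶜ} ∩ S) \ {e}).ncard = 4 := by
    rw [← Set.ncard_union_eq]
    · have h1 : ({g | G.src g ∈ W} ∩ S) \ {e} ∪ ({g | G.src g ∈ Wᶜ} ∩ S) \ {e} = S \ {e} := by
        ext g
        by_cases h : G.src g ∈ W <;> simp [h]
      rw [h1, Set.ncard_sdiff_singleton_of_mem he, hS]
    · exact Set.disjoint_left.2 fun g h1 h2 => h2.1.1 h1.1.1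
  by_cases hn : (({g | G.src g ∈ W} ∩ S) \ {e}).ncard ≤ 2
  · exact exists_splitWitness_of_cut hS he hWne hcut hcross hn
  · exact exists_splitWitness_of_cut hS he (W := Wᶜ) ⟨b, hb⟩ (fun g hg => not_congr (hcut g hg))
      (not_congr hcross) (by omega)

lemma IsConfigPartition.isRankSep_minor {S A B D C X Y : Set G.E}
    (hP : IsConfigPartition S A B D C) (hXY : X ∪ Y = Sᶜ) (hdisj : Disjoint X Y)
    (hr : G.linRank (X ∪ (A ∪ C)) + G.linRank (Y ∪ (B ∪ C)) ≤
      G.linRank Dᶜ + 1 + G.linRank C) :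
    (G.minorDC D C).IsRankSep {f | f.1 ∈ S} (minorVal D C ⁻¹' (X ∪ A)) := by
  have hS2 : ∀ e, e ∈ S ↔ (e ∈ A ∨ e ∈ B) ∨ e ∈ D ∨ e ∈ C := fun e => by
    rw [← hP.union_eq]; rfl
  have hXY2 : ∀ e, e ∈ X ∨ e ∈ Y ↔ e ∉ S := fun e => Set.ext_iff.1 hXY e
  have hXd : ∀ e, e ∈ X → e ∉ Y := fun e h => Set.disjoint_left.1 hdisj h
  have hAB : ∀ e, e ∈ A → e ∉ B := fun e h => Set.disjoint_left.1 hP.disjAB h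
  have hA : ∀ e, e ∈ A → e ∉ D ∪ C := fun e h => Set.disjoint_left.1 hP.disjA h
  have hB : ∀ e, e ∈ B → e ∉ D ∪ C := fun e h => Set.disjoint_left.1 hP.disjB h
  have hDC : ∀ e, e ∈ D → e ∉ C := fun e h => Set.disjoint_left.1 hP.disjDC h
  simp only [Set.mem_union] at hA hB
  have himg : ∀ Z : Set G.E, minorVal D C '' (minorVal D C ⁻¹' Z) = Z ∩ (D ∪ C)ᶜ := by
    intro Z
    rw [Set.image_preimage_eq_inter_range, range_minorVal]
  have hcompl : (minorVal D C ⁻¹' (X ∪ A))ᶜ = minorVal D C ⁻¹' (X ∪ A)ᶜ := rfl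
  have hcard : ∀ Z : Set G.E, (minorVal D C ⁻¹' Z ∩ {f | f.1 ∈ S}).ncard =
      (Z ∩ S ∩ (D ∪ C)ᶜ).ncard := by
    intro Z
    rw [← himg, Set.ncard_image_of_injective _ (minorVal_injective D C)]
    rfl
  have e1 : (X ∪ A) ∩ S ∩ (D ∪ C)ᶜ = A := by
    ext e
    simp only [Set.mem_inter_iff, Set.mem_union, Set.mem_compl_iff]
    grind only [hS2 e, hXY2 e, hXd e, hAB e, hA e, hB e]
  have e2 : (X ∪ A)ᶜ ∩ S ∩ (D ∪ C)ᶜ = B := by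
    ext e
    simp only [Set.mem_inter_iff, Set.mem_union, Set.mem_compl_iff]
    grind only [hS2 e, hXY2 e, hXd e, hAB e, hA e, hB e]
  have e3 : (X ∪ A) ∩ (D ∪ C)ᶜ ∪ C = X ∪ (A ∪ C) := by
    ext e
    simp only [Set.mem_inter_iff, Set.mem_union, Set.mem_compl_iff]
    grind only [hS2 e, hXY2 e, hXd e, hAB e, hA e, hB e]
  have e4 : (X ∪ A)ᶜ ∩ (D ∪ C)ᶜ ∪ C = Y ∪ (B ∪ C) := by
    ext e
    simp only [Set.mem_inter_iff, Set.mem_union, Set.mem_compl_iff]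
    grind only [hS2 e, hXY2 e, hXd e, hAB e, hA e, hB e]
  have e5 : (D ∪ C)ᶜ ∪ C = Dᶜ := by
    ext e
    simp only [Set.mem_union, Set.mem_compl_iff]
    grind only [hDC e]
  have l1 := linRank_minor_add D C (minorVal D C ⁻¹' (X ∪ A))
  have l2 := linRank_minor_add D C (minorVal D C ⁻¹' (X ∪ A)ᶜ)
  have l3 := linRank_minor_add D C Set.univ
  rw [himg, e3] at l1
  rw [himg, e4] at l2
  rw [Set.image_univ, range_minorVal, e5] at l3
  refine ⟨?_, ?_, ?_⟩
  · rw [hcard, e1, hP.cardA]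
  · rw [hcompl, hcard, e2, hP.cardB]
  · rw [hcompl]
    omega

lemma IsConfigPartition.splitWitness_minor [Nonempty G.V] {S A B D C : Set G.E}
    (hP : IsConfigPartition S A B D C) (hC : G.linRank C = C.ncard)
    (hD : Fintype.card G.V ≤ G.linRank Dᶜ + 1)
    (hT : ∀ T : Set G.E, Disjoint T S → Fintype.card G.V ≤ G.linRank (T ∪ (B ∪ C)) + 1 →
      G.linRank (T ∪ (A ∪ C)) = (T ∪ (A ∪ C)).ncard → False) :
    (G.minorDC D C).splitWitness {f | f.1 ∈ S} := by
  have hAS : A ⊆ S := by rw [← hP.union_eq]; exact fun e he => Or.inl (Or.inl he)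
  have hCS : C ⊆ S := by rw [← hP.union_eq]; exact fun e he => Or.inr (Or.inr he)
  have hDS : D ⊆ S := by rw [← hP.union_eq]; exact fun e he => Or.inr (Or.inl he)
  have hAC : Disjoint A C := hP.disjA.mono_right Set.subset_union_right
  have hBC : Disjoint B C := hP.disjB.mono_right Set.subset_union_right
  have cA : (A ∪ C).ncard = 2 + C.ncard := by rw [Set.ncard_union_eq hAC, hP.cardA]
  have cB : (B ∪ C).ncard = 2 + C.ncard := by rw [Set.ncard_union_eq hBC, hP.cardB]
  have hAD : A ∪ C ⊆ Dᶜ := fun e he hd => he.elim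
    (fun h => Set.disjoint_left.1 hP.disjA h (Or.inl hd))
    (fun h => Set.disjoint_left.1 hP.disjDC hd h)
  have hBD : B ∪ C ⊆ Dᶜ := fun e he hd => he.elim
    (fun h => Set.disjoint_left.1 hP.disjB h (Or.inl hd))
    (fun h => Set.disjoint_left.1 hP.disjDC hd h)
  have hconn : Fintype.card (G.minorDC D C).V ≤ (G.minorDC D C).linRank Set.univ + 1 := by
    have l3 := linRank_minor_add D C Set.univ
    have e5 : Dᶜ ⊆ (D ∪ C)ᶜ ∪ C := fun e he => by
      by_cases h : e ∈ C
      · exact Or.inr h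
      · exact Or.inl fun h' => h'.elim he h
    have l4 := linRank_mono e5
    rw [Set.image_univ, range_minorVal] at l3
    have l5 := card_minor_add D C
    omega
  suffices h : ∃ X Y : Set G.E, X ∪ Y = Sᶜ ∧ Disjoint X Y ∧
      G.linRank (X ∪ (A ∪ C)) + G.linRank (Y ∪ (B ∪ C)) ≤ G.linRank Dᶜ + 1 + G.linRank C by
    obtain ⟨X, Y, h1, h2, h3⟩ := h
    exact IsRankSep.splitWitness hconn (hP.isRankSep_minor h1 h2 h3)
  have rA := linRank_le_ncard (A ∪ C)
  have rB := linRank_le_ncard (B ∪ C)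
  by_cases hA : G.linRank (A ∪ C) = 2 + C.ncard
  · by_cases hB : G.linRank (B ∪ C) = 2 + C.ncard
    · by_contra! hcon
      have hV := linRank_add_one_le_card (A ∪ C)
      obtain ⟨T, hTS, hTc, hTA, hTB⟩ := exists_common_independent G.linRank linRank_mono
        linRank_union_add_inter_le
        (fun F e => by
          have h1 := linRank_union_le {e} F
          have h2 := linRank_singleton_le e
          rw [Set.singleton_union] at h1
          omega) Sᶜ (A ∪ C) (B ∪ C) (Fintype.card G.V - 3 - C.ncard) (fun X Y h1 h2 => by
            have := hcon X Y h1 h2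
            omega)
      have hTd : Disjoint T S := Set.disjoint_left.2 fun e he => hTS he
      refine hT T hTd (by omega) ?_
      rw [Set.ncard_union_eq (hTd.mono_right (Set.union_subset hAS hCS)), cA]
      omega
    · refine ⟨Sᶜ, ∅, by simp, by simp, ?_⟩
      have := linRank_mono (Set.union_subset (Set.compl_subset_compl.2 hDS) hAD)
      rw [Set.empty_union]
      omega
  · refine ⟨∅, Sᶜ, by simp, by simp, ?_⟩
    have := linRank_mono (Set.union_subset (Set.compl_subset_compl.2 hDS) hBD)
    rw [Set.empty_union]
    omega

lemma configSplits_iff_exists_splitWitness (hG : G.Connected) {S : Set G.E} (hS : S.ncard = 5) :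
    G.ConfigSplits S ↔
      ∃ e ∈ S,
        (G.minorDC {e} ∅).splitWitness {f | f.1 ∈ S} ∨
        (G.minorDC ∅ {e}).splitWitness {f | f.1 ∈ S} := by
  have := hG.nonempty
  constructor
  · intro h
    obtain ⟨A, B, D, C, hP, hT⟩ := (configSplits_iff S).1 h
    obtain ⟨e, ⟨rfl, rfl⟩ | ⟨rfl, rfl⟩⟩ := hP.single
    · have he : e ∈ S := by rw [← hP.union_eq]; exact Or.inr (Or.inl rfl)
      by_cases hD : Fintype.card G.V ≤ G.linRank {e}ᶜ + 1
      · refine ⟨e, he, Or.inl (hP.splitWitness_minor ?_ hD hT)⟩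
        have := linRank_le_ncard (∅ : Set G.E)
        rw [Set.ncard_empty] at this ⊢
        omega
      · obtain ⟨f, hf, hw⟩ := exists_splitWitness_of_bridge hG hS he (by omega)
        exact ⟨f, hf, Or.inl hw⟩
    · have he : e ∈ S := by rw [← hP.union_eq]; exact Or.inr (Or.inr rfl)
      by_cases hC : G.linRank {e} = 0
      · obtain ⟨f, hf, hw⟩ := exists_splitWitness_of_loop hS he hC
        exact ⟨f, hf, Or.inl hw⟩
      · refine ⟨e, he, Or.inr (hP.splitWitness_minor ?_ ?_ hT)⟩
        · have := linRank_singleton_le e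
          rw [Set.ncard_singleton]
          omega
        · rw [Set.compl_empty]
          exact hG.card_le_linRank_add_one
  · rintro ⟨e, he, h | h⟩
    · exact configSplits_of_splitWitness hS (by simpa using he) ⟨e, Or.inl ⟨rfl, rfl⟩⟩ h
    · exact configSplits_of_splitWitness hS (by simpa using he) ⟨e, Or.inr ⟨rfl, rfl⟩⟩ h

end Multigraph

/-! ### The statement -/

open Multigraph

theorem stmt13 (G : Multigraph) (hG : G.Connected) (S : Set G.E) (hS : S.ncard = 5) :
    G.ConfigSplits S ↔
      ∃ e ∈ S,
        (G.minorDC {e} ∅).splitWitness {f | f.1 ∈ S} ∨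
        (G.minorDC ∅ {e}).splitWitness {f | f.1 ∈ S} := by
  exact configSplits_iff_exists_splitWitness hG hS
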